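/- arXiv:1209.4547 — 2 statements merged into one kernel-verified Lean document; each statement's English description precedes it below -/
import Mathlib

section
/- Let n, N be natural numbers, and for each 1 ≤ j ≤ n let I_j be a finite subset of {1,...,N}. Let Q = ⊕_{j=1}^n p_{I_j} in C(∏_{j=1}^N S², K), where p_{I_j} is the pointwise tensor product of pullbacks of the Bott projection along the coordinates in I_j, and let e denote a trivial rank-one projection and m a natural number. Then m·e is NOT subequivalent to Q if and only if for every finite subset F ⊆ {1,...,n} one has |F| < |⋃_{j∈F} I_j| + m. -/
open Matrix

/-- The 2-sphere, as the unit sphere in `ℝ³`. -/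
def TwoSphere : Type := Metric.sphere (0 : EuclideanSpace ℝ (Fin 3)) 1

noncomputable instance : TopologicalSpace TwoSphere :=
  inferInstanceAs (TopologicalSpace (Metric.sphere (0 : EuclideanSpace ℝ (Fin 3)) 1))

/-- The Bott projection `p ∈ C(S², M₂(ℂ))`, corresponding to the Hopf line bundle:
`p(x,y,z) = ½ (1 + x σ_x + y σ_y + z σ_z)`. -/
noncomputable def bott (v : TwoSphere) : Matrix (Fin 2) (Fin 2) ℂ :=
  (1 / 2 : ℂ) •
    !![1 + (v.1 2 : ℂ), (v.1 0 : ℂ) - (v.1 1 : ℂ) * Complex.I;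
       (v.1 0 : ℂ) + (v.1 1 : ℂ) * Complex.I, 1 - (v.1 2 : ℂ)]

/-- A trivial rank-one `2×2` factor, the matrix unit `e₀₀`. -/
noncomputable def trivFactor : Matrix (Fin 2) (Fin 2) ℂ :=
  Matrix.of fun a b => if a = 0 ∧ b = 0 then 1 else 0

/-- The projection `p_I = ⊗_{i∈I} (p ∘ π_i)` over `X = ∏_{i=1}^N S²`, realized in
`C(X, M_{2^N}(ℂ))` as the pointwise Kronecker product which uses the pullback
`bott (x i)` of the Bott projection in the coordinates `i ∈ I` and a trivial rank-one
factor in the remaining coordinates. -/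
noncomputable def bottProj (N : ℕ) (I : Finset (Fin N)) (x : Fin N → TwoSphere) :
    Matrix (Fin N → Fin 2) (Fin N → Fin 2) ℂ :=
  Matrix.of fun a b => ∏ i, (if i ∈ I then bott (x i) else trivFactor) (a i) (b i)

/-- Murray–von Neumann subequivalence of (pointwise) projection-valued functions,
witnessed by a continuous partial isometry `v` with `v*v = p` and `vv* ≤ q`. -/
def CSubequiv {X : Type*} [TopologicalSpace X] {ι κ : Type*} [Fintype ι] [Fintype κ]
    (p : X → Matrix ι ι ℂ) (q : X → Matrix κ κ ℂ) : Prop :=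
  ∃ v : X → Matrix κ ι ℂ, Continuous v ∧
    ∀ x, (v x)ᴴ * v x = p x ∧ (v x * (v x)ᴴ) * q x = v x * (v x)ᴴ

namespace BottAux

section Cochain

variable {G D Λ : Type} [AddCommGroup G] [Fintype D] [Ring Λ] [Algebra ℝ Λ]

/-- Lattice exterior derivative. -/
noncomputable def dOp (e : D → G) (ε : D → Λ) : Module.End ℝ (G → Λ) where
  toFun ω x := ∑ μ, ε μ * (ω (x + e μ) - ω x)
  map_add' ω ω' := by
    funext x
    simp only [Pi.add_apply, ← Finset.sum_add_distrib]
    refine Finset.sum_congr rfl fun μ _ => ?_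
    noncomm_ring
  map_smul' r ω := by
    funext x
    simp only [Pi.smul_apply, ← smul_sub, mul_smul_comm, Finset.smul_sum, RingHom.id_apply]

/-- Cup product by a lattice one-cochain. -/
noncomputable def L1 (e : D → G) (ε : D → Λ) (α : D → G → ℝ) : Module.End ℝ (G → Λ) where
  toFun ω x := ∑ μ, α μ x • (ε μ * ω (x + e μ))
  map_add' ω ω' := by
    funext x
    simp only [Pi.add_apply, ← Finset.sum_add_distrib, mul_add, smul_add]
  map_smul' r ω := by
    funext x
    simp only [Pi.smul_apply, mul_smul_comm, Finset.smul_sum, RingHom.id_apply]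
    exact Finset.sum_congr rfl fun μ _ => smul_comm _ _ _

/-- Cup product by a lattice two-cochain. -/
noncomputable def L2 (e : D → G) (ε : D → Λ) (c : D → D → G → ℝ) : Module.End ℝ (G → Λ) where
  toFun ω x := ∑ μ, ∑ ν, c μ ν x • (ε μ * ε ν * ω (x + e μ + e ν))
  map_add' ω ω' := by
    funext x
    simp only [Pi.add_apply, ← Finset.sum_add_distrib, mul_add, smul_add]
  map_smul' r ω := by
    funext x
    simp only [Pi.smul_apply, mul_smul_comm, Finset.smul_sum, RingHom.id_apply]
    exact Finset.sum_congr rfl fun μ _ => Finset.sum_congr rfl fun ν _ => smul_comm _ _ _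

variable (e : D → G) (ε : D → Λ)

/-- A double sum which is symmetric against anticommuting variables vanishes. -/
lemma sum_symm_zero (hε : ∀ μ ν, ε μ * ε ν = -(ε ν * ε μ)) (F : D → D → Λ) (hF : ∀ μ ν, F μ ν = F ν μ) :
    ∑ μ, ∑ ν, ε μ * ε ν * F μ ν = 0 := by
  have h : ∑ μ, ∑ ν, ε μ * ε ν * F μ ν = -∑ μ, ∑ ν, ε μ * ε ν * F μ ν := by
    conv_lhs => rw [Finset.sum_comm]
    rw [← Finset.sum_neg_distrib]
    refine Finset.sum_congr rfl fun μ _ => ?_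
    rw [← Finset.sum_neg_distrib]
    refine Finset.sum_congr rfl fun ν _ => ?_
    rw [hε ν μ, hF ν μ]; noncomm_ring
  have h2 : (2 : ℝ) • ∑ μ, ∑ ν, ε μ * ε ν * F μ ν = 0 := by
    rw [two_smul]; nth_rewrite 1 [h]; simp
  exact (smul_eq_zero.mp h2).resolve_left (by norm_num)

lemma dOp_sq (hε : ∀ μ ν, ε μ * ε ν = -(ε ν * ε μ)) : dOp e ε * dOp e ε = 0 := by
  ext ω x
  simp only [Module.End.mul_apply, dOp, LinearMap.coe_mk, AddHom.coe_mk, LinearMap.zero_apply,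
    Pi.zero_apply]
  rw [← sum_symm_zero ε hε (fun μ ν => ω (x + e μ + e ν) - ω (x + e μ) - ω (x + e ν) + ω x)]
  · refine Finset.sum_congr rfl fun μ _ => ?_
    rw [← Finset.sum_sub_distrib, Finset.mul_sum]
    refine Finset.sum_congr rfl fun ν _ => ?_
    noncomm_ring
  · intro μ ν
    rw [add_right_comm x (e μ) (e ν)]; abel

lemma dOp_L1 (hε : ∀ μ ν, ε μ * ε ν = -(ε ν * ε μ)) (α : D → G → ℝ) :
    dOp e ε * L1 e ε α + L1 e ε α * dOp e ε
      = L2 e ε (fun μ ν x => α ν (x + e μ) - α ν x) := by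
  ext ω x
  simp only [Module.End.mul_apply, dOp, L1, L2, LinearMap.coe_mk, AddHom.coe_mk,
    LinearMap.add_apply, Pi.add_apply]
  have h1 : ∀ μ, ε μ * (∑ ν, α ν (x + e μ) • (ε ν * ω (x + e μ + e ν))
      - ∑ ν, α ν x • (ε ν * ω (x + e ν)))
      = ∑ ν, (α ν (x + e μ) • (ε μ * ε ν * ω (x + e μ + e ν)) - α ν x • (ε μ * ε ν * ω (x + e ν))) := by
    intro μ
    rw [← Finset.sum_sub_distrib, Finset.mul_sum]
    refine Finset.sum_congr rfl fun ν _ => ?_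
    rw [mul_sub, mul_smul_comm, mul_smul_comm, mul_assoc, mul_assoc]
  have h2 : ∑ μ, α μ x • (ε μ * ∑ ν, ε ν * (ω (x + e μ + e ν) - ω (x + e μ)))
      = ∑ μ, ∑ ν, (-(α ν x • (ε μ * ε ν * ω (x + e μ + e ν))) + α ν x • (ε μ * ε ν * ω (x + e ν))) := by
    rw [Finset.sum_comm]
    refine Finset.sum_congr rfl fun μ _ => ?_
    rw [Finset.mul_sum, Finset.smul_sum]
    refine Finset.sum_congr rfl fun ν _ => ?_
    rw [hε ν μ, add_right_comm x (e ν) (e μ)]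
    rw [mul_sub, mul_sub, smul_sub, neg_mul, neg_mul, smul_neg, smul_neg, neg_neg, mul_assoc,
      mul_assoc]
    abel
  rw [Finset.sum_congr rfl fun μ _ => h1 μ, h2, ← Finset.sum_add_distrib]
  refine Finset.sum_congr rfl fun μ _ => ?_
  rw [← Finset.sum_add_distrib]
  refine Finset.sum_congr rfl fun ν _ => ?_
  rw [sub_smul]; abel

lemma dOp_L2_const (hε : ∀ μ ν, ε μ * ε ν = -(ε ν * ε μ)) (W : D → D → ℝ) :
    dOp e ε * L2 e ε (fun μ ν _ => W μ ν) = L2 e ε (fun μ ν _ => W μ ν) * dOp e ε := by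
  ext ω x
  simp only [Module.End.mul_apply, dOp, L2, LinearMap.coe_mk, AddHom.coe_mk]
  simp only [← Finset.sum_sub_distrib, Finset.mul_sum, Finset.smul_sum]
  rw [Finset.sum_comm]
  refine Finset.sum_congr rfl fun μ _ => ?_
  rw [Finset.sum_comm]
  refine Finset.sum_congr rfl fun ν _ => ?_
  refine Finset.sum_congr rfl fun κ _ => ?_
  rw [← smul_sub, mul_smul_comm, ← mul_sub]
  congr 1
  have : ε κ * (ε μ * ε ν) = ε μ * ε ν * ε κ := by
    rw [← mul_assoc, hε κ μ, neg_mul, mul_assoc, hε κ ν, mul_neg, neg_neg, mul_assoc]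
  rw [← mul_assoc, this, mul_assoc (ε μ * ε ν)]
  congr 4; abel_nf

/-- Summation over the lattice kills exact cochains. -/
lemma sum_dOp [Fintype G] (ω : G → Λ) : ∑ x, dOp e ε ω x = 0 := by
  simp only [dOp, LinearMap.coe_mk, AddHom.coe_mk]
  rw [Finset.sum_comm]
  refine Finset.sum_eq_zero fun μ _ => ?_
  have h : ∑ x, ω (x + e μ) = ∑ x, ω x := Equiv.sum_comp (Equiv.addRight (e μ)) ω
  rw [← Finset.mul_sum, Finset.sum_sub_distrib, h, sub_self, mul_zero]

lemma dOp_one : dOp e ε (1 : G → Λ) = 0 := by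
  ext x; simp [dOp]

/-- Products of chain maps which are pairwise chain homotopic are chain homotopic. -/
lemma homotopic_prod {R : Type*} [Ring R] {J : Type*} (d : R) (c r : J → R)
    (hr : ∀ j, d * r j = r j * d) (hc : ∀ j, d * c j = c j * d)
    (h : ∀ j, ∃ b, c j - r j = d * b + b * d) (l : List J) :
    d * (l.map c).prod = (l.map c).prod * d ∧
    ∃ b, (l.map c).prod - (l.map r).prod = d * b + b * d := by
  induction l with
  | nil => exact ⟨by simp, 0, by simp⟩
  | cons j l ih =>
    obtain ⟨h1, b', hb'⟩ := ih
    obtain ⟨b, hb⟩ := h j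
    simp only [List.map_cons, List.prod_cons]
    refine ⟨by rw [← mul_assoc, hc, mul_assoc, h1, mul_assoc], b * (l.map c).prod + r j * b', ?_⟩
    have : c j * (l.map c).prod - r j * (l.map r).prod
      = (c j - r j) * (l.map c).prod + r j * ((l.map c).prod - (l.map r).prod) := by noncomm_ring
    rw [this, hb, hb', add_mul, mul_add, mul_add, add_mul, mul_assoc b d, h1, ← mul_assoc d (r j), hr]
    noncomm_ring

/-- Points reachable from `x` in at most `k` double steps. -/
def Reach (e : D → G) : ℕ → G → G → Prop
  | 0, x, y => y = x
  | k + 1, x, y => y = x ∨ ∃ μ ν, Reach e k (x + e μ + e ν) y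

lemma Reach.self (k : ℕ) (x : G) : Reach e k x x := by
  cases k <;> simp [Reach]

/-- Locality of products. -/
lemma prod_local (hε : ∀ μ ν, ε μ * ε ν = -(ε ν * ε μ)) {J : Type*} (c : J → D → D → G → ℝ) (j0 : J) (l : List J) (hj : j0 ∈ l) :
    ∀ (x : G) (_ : ∀ y, Reach e l.length x y → ∀ μ ν, c j0 μ ν y = c j0 ν μ y) (ω : G → Λ),
      (l.map fun j => L2 e ε (c j)).prod ω x = 0 := by
  induction l with
  | nil => simp at hj
  | cons j l ih =>
    intro x hx ω
    simp only [List.map_cons, List.prod_cons, Module.End.mul_apply]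
    by_cases hjj : j0 = j
    · subst hjj
      set ω' := (l.map fun j => L2 e ε (c j)).prod ω
      simp only [L2, LinearMap.coe_mk, AddHom.coe_mk]
      rw [← sum_symm_zero ε hε (fun μ ν => c j0 μ ν x • ω' (x + e μ + e ν))]
      · simp only [mul_smul_comm]
      · intro μ ν
        rw [hx x (Reach.self e _ x) μ ν, add_right_comm]
    · have hj' : j0 ∈ l := by simpa [hjj] using hj
      change ∑ μ, ∑ ν, _ = _
      refine Finset.sum_eq_zero fun μ _ => Finset.sum_eq_zero fun ν _ => ?_
      rw [ih hj' (x + e μ + e ν) (fun y hy => hx y (Or.inr ⟨μ, ν, hy⟩)) ω]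
      simp

/-- Product of constant cochains. -/
lemma prod_const {J : Type*} (W : J → D → D → ℝ) (l : List J) :
    (l.map fun j => L2 e ε (fun μ ν (_ : G) => W j μ ν)).prod (1 : G → Λ)
      = fun _ => (l.map fun j => ∑ μ, ∑ ν, W j μ ν • (ε μ * ε ν)).prod := by
  induction l with
  | nil => funext x; simp
  | cons j l ih =>
    simp only [List.map_cons, List.prod_cons, Module.End.mul_apply]
    rw [ih]
    funext x
    simp only [L2, LinearMap.coe_mk, AddHom.coe_mk, Finset.sum_mul, smul_mul_assoc]

/-- The abstract vanishing theorem. -/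
theorem cochain_main (hε : ∀ μ ν, ε μ * ε ν = -(ε ν * ε μ))
    [Fintype G] {J : Type*} (W : J → D → D → ℝ) (θ : J → D → G → ℝ) (l : List J)
    (hloc : ∀ x : G, ∃ j ∈ l, ∀ y, Reach e l.length x y → ∀ μ ν,
      θ j ν (y + e μ) - θ j ν y - W j μ ν = θ j μ (y + e ν) - θ j μ y - W j ν μ) :
    (l.map fun j => ∑ μ, ∑ ν, W j μ ν • (ε μ * ε ν)).prod = 0 := by
  set r : J → Module.End ℝ (G → Λ) := fun j => L2 e ε (fun μ ν (_ : G) => W j μ ν) with hr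
  set c : J → Module.End ℝ (G → Λ) := fun j =>
    L2 e ε (fun μ ν y => W j μ ν - (θ j ν (y + e μ) - θ j ν y)) with hc
  have hcr : ∀ j, c j = r j + (dOp e ε * (L1 e ε (-θ j)) + (L1 e ε (-θ j)) * dOp e ε) := by
    intro j
    rw [dOp_L1 e ε hε (-θ j)]
    ext ω x
    simp only [hc, hr, L2, LinearMap.coe_mk, AddHom.coe_mk, Pi.neg_apply,
      LinearMap.add_apply, Pi.add_apply, ← Finset.sum_add_distrib, ← add_smul]
    refine Finset.sum_congr rfl fun μ _ => Finset.sum_congr rfl fun ν _ => ?_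
    congr 1
    ring
  have hrd : ∀ j, dOp e ε * r j = r j * dOp e ε := fun j => dOp_L2_const e ε hε (W j)
  have hdd := dOp_sq e ε hε
  have hcd : ∀ j, dOp e ε * c j = c j * dOp e ε := by
    intro j
    rw [hcr, mul_add, add_mul, hrd, mul_add, add_mul, ← mul_assoc, hdd, zero_mul,
      mul_assoc _ (dOp e ε) (dOp e ε), hdd, mul_zero, mul_assoc]
    simp
  obtain ⟨-, b, hb⟩ := homotopic_prod (dOp e ε) c r hrd hcd
    (fun j => ⟨_, by rw [hcr j, add_sub_cancel_left]⟩) l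
  have hzero : (l.map c).prod (1 : G → Λ) = 0 := by
    funext x
    obtain ⟨j, hj, h⟩ := hloc x
    exact prod_local e ε hε (fun j μ ν y => W j μ ν - (θ j ν (y + e μ) - θ j ν y)) j l hj x
      (fun y hy μ ν => by have := h y hy μ ν; linarith) 1
  have h1 := congrArg (fun T : Module.End ℝ (G → Λ) => ∑ x, T 1 x) hb
  simp only [LinearMap.sub_apply, LinearMap.add_apply, Module.End.mul_apply, dOp_one, map_zero,
    add_zero, sum_dOp, hzero] at h1
  rw [hr, prod_const] at h1
  simp only [Pi.sub_apply, Pi.zero_apply, zero_sub, Finset.sum_const, Finset.card_univ] at h1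
  have hG : Fintype.card G ≠ 0 := Fintype.card_ne_zero
  rw [smul_neg, neg_eq_zero, ← Nat.cast_smul_eq_nsmul ℝ, smul_eq_zero] at h1
  exact h1.resolve_left (by exact_mod_cast hG)

end Cochain

section Exterior

variable {n : ℕ}

/-- Generators of the exterior algebra. -/
noncomputable def eps (μ : Fin n × Bool) : ExteriorAlgebra ℝ ((Fin n × Bool) → ℝ) :=
  ExteriorAlgebra.ι ℝ (Pi.single μ 1)

lemma eps_anti (μ ν : Fin n × Bool) : eps μ * eps ν = -(eps ν * eps μ) := by
  have := ExteriorAlgebra.ι_add_mul_swap (R := ℝ) (Pi.single μ (1:ℝ)) (Pi.single ν (1:ℝ) : (Fin n × Bool) → ℝ)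
  exact eq_neg_of_add_eq_zero_left this

open CliffordAlgebra in
lemma contract_eps (μ : Fin n × Bool) (l : List (Fin n × Bool)) (h : μ ∉ l) :
    contractLeft (Q := (0 : QuadraticForm ℝ ((Fin n × Bool) → ℝ)))
      (LinearMap.proj μ) (l.map eps).prod = 0 := by
  induction l with
  | nil => simp 
  | cons ν l ih =>
    simp only [List.map_cons, List.prod_cons]
    have hne : μ ≠ ν := fun h' => h (by simp [h'])
    rw [show (eps ν) = ι (0 : QuadraticForm ℝ ((Fin n × Bool) → ℝ)) (Pi.single ν 1) from rfl]
    erw [contractLeft_ι_mul, ih (fun h' => h (by simp [h']))]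
    simp [hne]

open CliffordAlgebra in
lemma prod_eps_ne (l : List (Fin n × Bool)) (h : l.Nodup) : (l.map eps).prod ≠ 0 := by
  induction l with
  | nil => simp
  | cons ν l ih =>
    intro h0
    rw [List.nodup_cons] at h
    apply ih h.2
    have := congrArg (contractLeft (Q := (0 : QuadraticForm ℝ ((Fin n × Bool) → ℝ)))
      (LinearMap.proj ν)) h0
    simp only [List.map_cons, List.prod_cons] at this
    rw [show (eps ν) = ι (0 : QuadraticForm ℝ ((Fin n × Bool) → ℝ)) (Pi.single ν 1) from rfl] at this
    erw [contractLeft_ι_mul, contract_eps ν l h.1] at this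
    simpa using this

/-- The even generators. -/
noncomputable def eta (i : Fin n) : ExteriorAlgebra ℝ ((Fin n × Bool) → ℝ) :=
  eps (i, false) * eps (i, true)

lemma prod_eta (l : List (Fin n)) :
    (l.map eta).prod = ((l.flatMap fun i => [(i, false), (i, true)]).map eps).prod := by
  induction l with
  | nil => simp
  | cons i l ih => simp [ih, eta, mul_assoc]

lemma prod_eta_ne : ((List.finRange n).map eta).prod ≠ 0 := by
  rw [prod_eta]
  apply prod_eps_ne
  rw [List.nodup_flatMap]
  refine ⟨fun i _ => by simp, ?_⟩
  refine (List.nodup_finRange n).imp ?_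
  intro a b hab
  simp [Function.onFun, hab.symm]

lemma eta_comm (i j : Fin n) : eta i * eta j = eta j * eta i := by
  have h : ∀ μ, eps μ * eta j = eta j * eps μ := by
    intro μ
    rw [eta, ← mul_assoc, eps_anti μ, neg_mul, mul_assoc, eps_anti μ, mul_neg, neg_neg, mul_assoc]
  rw [eta, mul_assoc, h, ← mul_assoc, h, mul_assoc]

lemma eta_sq (i : Fin n) : eta i * eta i = 0 := by
  have h : eps (i, true) * eps (i, true) = 0 := ExteriorAlgebra.ι_sq_zero _
  have h2 := eps_anti (i, true) (i, false)
  calc eta i * eta i = eps (i, false) * (eps (i, true) * eps (i, false)) * eps (i, true) := by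
        simp only [eta, mul_assoc]
    _ = -(eps (i, false) * eps (i, false) * (eps (i, true) * eps (i, true))) := by
        rw [h2]; simp only [mul_neg, neg_mul, mul_assoc]
    _ = 0 := by rw [h]; simp

lemma prod_sum_eta_ne (A : Fin n → Fin n → ℝ) (hA : ∀ i j, 0 ≤ A i j) (hd : ∀ j, 0 < A j j) :
    ((List.finRange n).map fun j => ∑ i, A j i • eta i).prod ≠ 0 := by
  have hcomm : IsMulCommutative (Algebra.adjoin ℝ (Set.range (eta (n := n)))) :=
    Algebra.isMulCommutative_adjoin ℝ (by
      rintro _ ⟨i, rfl⟩ _ ⟨j, rfl⟩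
      exact eta_comm i j)
  let _ : CommRing (Algebra.adjoin ℝ (Set.range (eta (n := n)))) :=
    { (inferInstance : Ring (Algebra.adjoin ℝ (Set.range (eta (n := n))))) with
      mul_comm := fun a b => hcomm.is_comm.comm a b }
  let η : Fin n → Algebra.adjoin ℝ (Set.range (eta (n := n))) :=
    fun i => ⟨eta i, Algebra.subset_adjoin ⟨i, rfl⟩⟩
  have hη2 : ∀ i, η i * η i = 0 := fun i => Subtype.ext (eta_sq i)
  have hprod : ∏ i, η i ≠ 0 := by
    intro h
    apply prod_eta_ne (n := n)
    have h2 := congrArg (Subalgebra.val _) h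
    rw [Fin.prod_univ_def, map_list_prod, List.map_map, map_zero] at h2
    exact h2
  intro h0
  have h1 : ∏ j, ∑ i, A j i • η i = 0 := by
    apply Subtype.val_injective
    change (Subalgebra.val _) _ = 0
    rw [Fin.prod_univ_def, map_list_prod, List.map_map, ← h0]
    congr 2
    funext j
    simp [η]
  rw [Finset.prod_univ_sum] at h1
  have h2 : ∀ s ∈ Fintype.piFinset (fun _ : Fin n => (Finset.univ : Finset (Fin n))),
      ∏ j, A j (s j) • η (s j)
      = (if Function.Bijective s then ∏ j, A j (s j) else 0) • ∏ i, η i := by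
    intro s _
    rw [Finset.prod_smul]
    split_ifs with hs
    · congr 1
      exact hs.prod_comp η
    · rw [zero_smul]
      have : ¬ Function.Injective s := fun h => hs (Finite.injective_iff_bijective.mp h)
      simp only [Function.Injective, not_forall] at this
      obtain ⟨a, b, hab, hne⟩ := this
      have hz : ∏ j, η (s j) = 0 := by
        rw [← Finset.mul_prod_erase _ _ (Finset.mem_univ a),
          ← Finset.mul_prod_erase _ _ (Finset.mem_erase.mpr ⟨Ne.symm hne, Finset.mem_univ b⟩),
          ← mul_assoc, hab, hη2, zero_mul]
      rw [hz, smul_zero]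
  rw [Finset.sum_congr rfl h2, ← Finset.sum_smul, smul_eq_zero] at h1
  have hpos : 0 < ∑ s ∈ Fintype.piFinset (fun _ : Fin n => (Finset.univ : Finset (Fin n))),
      (if Function.Bijective s then ∏ j, A j (s j) else 0) := by
    refine Finset.sum_pos' (fun s _ => ?_) ⟨id, by simp, ?_⟩
    · split_ifs
      · exact Finset.prod_nonneg fun j _ => hA _ _
      · exact le_rfl
    · rw [if_pos Function.bijective_id]
      exact Finset.prod_pos fun j _ => hd j
  exact h1.elim hpos.ne' hprod

end Exterior
end BottAux

namespace BottAux
section Core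
open Complex

lemma arg_lemma (t1 t2 t3 t4 : ℂ) (h1 : t1 ≠ 0) (h2 : t2 ≠ 0) (h3 : t3 ≠ 0) (h4 : t4 ≠ 0)
    (w w' : ℝ) (h : t1 * t4 * exp (w' * I) = t3 * t2 * exp (w * I))
    (b1 : |arg t1| < Real.pi / 4) (b2 : |arg t2| < Real.pi / 4) (b3 : |arg t3| < Real.pi / 4)
    (b4 : |arg t4| < Real.pi / 4) (bw : |w' - w| < Real.pi) :
    arg t1 - arg t2 - w = arg t3 - arg t4 - w' := by
  have hang : ((arg t1 + arg t4 + w' : ℝ) : Real.Angle) = ((arg t3 + arg t2 + w : ℝ) : Real.Angle) := by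
    have := congrArg (fun z => (arg z : Real.Angle)) h
    beta_reduce at this
    rw [arg_mul_coe_angle (mul_ne_zero h1 h4) (exp_ne_zero _), arg_mul_coe_angle h1 h4,
      arg_mul_coe_angle (mul_ne_zero h3 h2) (exp_ne_zero _), arg_mul_coe_angle h3 h2] at this
    have he : ∀ v : ℝ, ((arg (exp (v * I)) : ℝ) : Real.Angle) = (v : Real.Angle) := by
      intro v
      rw [Complex.arg_exp_mul_I]
      exact Real.Angle.coe_toIocMod _ _
    rw [he, he] at this
    push_cast
    exact this
  rw [Real.Angle.angle_eq_iff_two_pi_dvd_sub] at hang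
  obtain ⟨k, hk⟩ := hang
  rw [abs_lt] at b1 b2 b3 b4 bw
  have hpi := Real.pi_pos
  have hk0 : k = 0 := by
    have k1 : (k : ℝ) < 1 := by nlinarith
    have k2 : (-1 : ℝ) < k := by nlinarith
    have k1' : k < 1 := by exact_mod_cast k1
    have k2' : -1 < k := by exact_mod_cast k2
    omega
  rw [hk0] at hk
  push_cast at hk
  linarith

variable {n : ℕ}

/-- Lattice point to real point. -/
noncomputable def pt (M : ℕ) (x : Fin n × Bool → ℤ) : Fin n × Bool → ℝ := fun μ => (x μ : ℝ) / M

/-- Connection. -/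
noncomputable def conn (A : Fin n → ℝ) (μ : Fin n × Bool) (P : Fin n × Bool → ℝ) : ℝ :=
  if μ.2 then 2 * Real.pi * A μ.1 * P (μ.1, false) else 0

/-- Link variable. -/
noncomputable def link (M : ℕ) (f : (Fin n × Bool → ℝ) → ℂ) (A : Fin n → ℝ) (μ : Fin n × Bool)
    (x : Fin n × Bool → ℤ) : ℂ :=
  f (pt M (x + Pi.single μ 1)) * exp (((1 / M : ℝ) * conn A μ (pt M x) : ℝ) * I) / f (pt M x)

lemma pt_add_period (M : ℕ) (hM : M ≠ 0) (x : Fin n × Bool → ℤ) (ν : Fin n × Bool) :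
    pt M (x + Pi.single ν (M : ℤ)) = pt M x + Pi.single ν 1 := by
  have hM' : (M : ℝ) ≠ 0 := by exact_mod_cast hM
  funext μ
  by_cases h : μ = ν
  · subst h; simp [pt]; field_simp
  · simp [pt, h]

lemma link_periodic (M : ℕ) (hM : M ≠ 0) (f : (Fin n × Bool → ℝ) → ℂ) (A : Fin n → ℝ)
    (hX : ∀ P i, f (P + Pi.single (i, false) 1)
      = exp ((-(2 * Real.pi * A i * P (i, true)) : ℝ) * I) * f P)
    (hY : ∀ P i, f (P + Pi.single (i, true) 1) = f P) (μ ν : Fin n × Bool) :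
    Function.Periodic (link M f A μ) (Pi.single ν (M : ℤ)) := by
  intro x
  have hM' : (M : ℝ) ≠ 0 := by exact_mod_cast hM
  have hM'' : (M : ℂ) ≠ 0 := by exact_mod_cast hM
  unfold link
  rw [add_right_comm x, pt_add_period M hM, pt_add_period M hM]
  obtain ⟨i, b⟩ := ν
  cases b with
  | true =>
    rw [hY, hY]
    have : conn A μ (pt M x + Pi.single (i, true) 1) = conn A μ (pt M x) := by
      simp [conn]
    rw [this]
  | false =>
    rw [hX, hX]
    have key : exp ((-(2 * Real.pi * A i * pt M (x + Pi.single μ 1) (i, true)) : ℝ) * I)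
        * exp (((1 / M : ℝ) * conn A μ (pt M x + Pi.single (i, false) 1) : ℝ) * I)
        = exp ((-(2 * Real.pi * A i * pt M x (i, true)) : ℝ) * I)
        * exp (((1 / M : ℝ) * conn A μ (pt M x) : ℝ) * I) := by
      rw [← exp_add, ← exp_add, ← add_mul, ← add_mul, ← ofReal_add, ← ofReal_add]
      congr 3
      obtain ⟨i', b'⟩ := μ
      cases b' with
      | false => simp [conn, pt]
      | true =>
        by_cases hi : i = i'
        · subst hi; simp [conn, pt]; field_simp; ring
        · have hi' : i' ≠ i := fun h => hi h.symm
          simp [conn, pt, hi, hi']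
    set E1 := exp ((-(2 * Real.pi * A i * pt M x (i, true)) : ℝ) * I) with hE1
    have hE : E1 ≠ 0 := exp_ne_zero _
    rw [mul_right_comm, key, mul_assoc, mul_div_mul_left _ _ hE, mul_comm (exp _)]

lemma periodic_all {β : Type*} (M : ℕ) (h : (Fin n × Bool → ℤ) → β)
    (hp : ∀ ν, Function.Periodic h (Pi.single ν (M : ℤ))) (x y : Fin n × Bool → ℤ)
    (hxy : ∀ μ, ((x μ : ℤ) : ZMod M) = (y μ : ZMod M)) : h x = h y := by
  have h1 : ∀ μ, ∃ k : ℤ, x μ = y μ + k * M := by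
    intro μ
    have := (ZMod.intCast_eq_intCast_iff_dvd_sub _ _ _).mp (hxy μ).symm
    obtain ⟨k, hk⟩ := this
    exact ⟨k, by linarith⟩
  choose z hz using h1
  have h2 : Function.Periodic h (∑ μ, z μ • Pi.single μ (M : ℤ)) := by
    refine Finset.sum_induction _ (Function.Periodic h) (fun a b ha hb => ha.add_period hb) ?_ ?_
    · intro x; simp
    · intro μ _
      exact (hp μ).zsmul (z μ)
  have h3 : x = y + ∑ μ, z μ • Pi.single μ (M : ℤ) := by
    funext μ
    rw [hz μ]
    simp [Finset.sum_apply, Pi.single_apply]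
  rw [h3, h2]

/-- Projection of the integer lattice to the finite torus. -/
def projL (M : ℕ) (z : Fin n × Bool → ℤ) : Fin n × Bool → ZMod M := fun μ => (z μ : ZMod M)

lemma projL_add (M : ℕ) (z : Fin n × Bool → ℤ) (μ : Fin n × Bool) :
    projL M z + Pi.single μ 1 = projL M (z + Pi.single μ 1) := by
  funext ν
  by_cases h : ν = μ
  · subst h; simp [projL]
  · simp [projL, h]

lemma reach_proj (M : ℕ) (k : ℕ) : ∀ (z : Fin n × Bool → ℤ) (y : Fin n × Bool → ZMod M),
    Reach (fun μ => Pi.single μ 1) k (projL M z) y →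
      ∃ z', y = projL M z' ∧ ∀ μ, z μ ≤ z' μ ∧ z' μ ≤ z μ + 2 * k := by
  induction k with
  | zero =>
    intro z y h
    exact ⟨z, h, fun μ => by simp⟩
  | succ k ih =>
    intro z y h
    rcases h with h | ⟨μ, ν, h⟩
    · exact ⟨z, h, fun μ => by constructor <;> push_cast <;> omega⟩
    · simp only [projL_add] at h
      obtain ⟨z', rfl, hz'⟩ := ih _ y h
      refine ⟨z', rfl, fun κ => ?_⟩
      have := hz' κ
      have h1 : (0 : ℤ) ≤ (Pi.single μ 1 : Fin n × Bool → ℤ) κ ∧ (Pi.single μ 1 : Fin n × Bool → ℤ) κ ≤ 1 := by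
        by_cases h : κ = μ
        · subst h; simp
        · simp [h]
      have h2 : (0 : ℤ) ≤ (Pi.single ν 1 : Fin n × Bool → ℤ) κ ∧ (Pi.single ν 1 : Fin n × Bool → ℤ) κ ≤ 1 := by
        by_cases h : κ = ν
        · subst h; simp
        · simp [h]
      simp only [Pi.add_apply] at this
      push_cast
      constructor <;> omega

/-- Constant curvature. -/
noncomputable def curv (M : ℕ) (A : Fin n → ℝ) (μ ν : Fin n × Bool) : ℝ :=
  if μ = (ν.1, false) ∧ ν.2 = true then 2 * Real.pi * A ν.1 / (M : ℝ) ^ 2 else 0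

lemma conn_curv (M : ℕ) (A : Fin n → ℝ) (μ ν : Fin n × Bool) (x : Fin n × Bool → ℤ) :
    (1 / M : ℝ) * conn A ν (pt M (x + Pi.single μ 1))
      = (1 / M : ℝ) * conn A ν (pt M x) + curv M A μ ν := by
  obtain ⟨i, b⟩ := ν
  cases b with
  | false => simp [conn, curv]
  | true =>
    by_cases h : μ = (i, false)
    · subst h; simp [conn, curv, pt]; ring
    · have h' : (i, false) ≠ μ := fun h' => h h'.symm
      simp [conn, curv, pt, h, h']

lemma link_plaquette (M : ℕ) (hM : 4 ≤ M) (f : (Fin n × Bool → ℝ) → ℂ) (A : Fin n → ℝ)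
    (hA0 : ∀ i, 0 ≤ A i) (hA1 : ∀ i, A i ≤ 1) (μ ν : Fin n × Bool) (z : Fin n × Bool → ℤ)
    (h1 : f (pt M z) ≠ 0) (h2 : f (pt M (z + Pi.single μ 1)) ≠ 0)
    (h3 : f (pt M (z + Pi.single ν 1)) ≠ 0)
    (h4 : f (pt M (z + Pi.single μ 1 + Pi.single ν 1)) ≠ 0)
    (b1 : |arg (link M f A ν (z + Pi.single μ 1))| < Real.pi / 4)
    (b2 : |arg (link M f A ν z)| < Real.pi / 4)
    (b3 : |arg (link M f A μ (z + Pi.single ν 1))| < Real.pi / 4)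
    (b4 : |arg (link M f A μ z)| < Real.pi / 4) :
    arg (link M f A ν (z + Pi.single μ 1)) - arg (link M f A ν z) - curv M A μ ν
      = arg (link M f A μ (z + Pi.single ν 1)) - arg (link M f A μ z) - curv M A ν μ := by
  have hc : ∀ κ τ : Fin n × Bool, 0 ≤ curv M A κ τ ∧ curv M A κ τ ≤ Real.pi / 2 := by
    intro κ τ
    unfold curv
    have hpi := Real.pi_pos
    split_ifs
    · have h0 := hA0 τ.1
      have h1 := hA1 τ.1
      have hM' : (4 : ℝ) ≤ M := by exact_mod_cast hM
      refine ⟨by positivity, ?_⟩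
      rw [div_le_iff₀ (by positivity)]
      have h16 : (16 : ℝ) ≤ (M : ℝ) ^ 2 := by nlinarith
      have hA' : Real.pi * A τ.1 ≤ Real.pi := by nlinarith
      nlinarith
    · exact ⟨le_rfl, by positivity⟩
  have h4' : f (pt M (z + Pi.single ν 1 + Pi.single μ 1)) ≠ 0 := by rwa [add_right_comm]
  apply arg_lemma _ _ _ _ _ _ _ _ _ _ _ b1 b2 b3 b4
  · have := hc μ ν
    have := hc ν μ
    rw [abs_lt]
    have hpi := Real.pi_pos
    constructor <;> linarith
  · exact div_ne_zero (mul_ne_zero h4 (exp_ne_zero _)) h2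
  · exact div_ne_zero (mul_ne_zero h3 (exp_ne_zero _)) h1
  · exact div_ne_zero (mul_ne_zero h4' (exp_ne_zero _)) h3
  · exact div_ne_zero (mul_ne_zero h2 (exp_ne_zero _)) h1
  · unfold link
    rw [conn_curv, conn_curv, ofReal_add, ofReal_add, add_mul, add_mul, exp_add, exp_add,
      add_right_comm z (Pi.single ν 1)]
    field_simp

theorem core (f : Fin n → (Fin n × Bool → ℝ) → ℂ) (hf : ∀ j, Continuous (f j))
    (A : Fin n → Fin n → ℝ) (hA0 : ∀ j i, 0 ≤ A j i) (hA1 : ∀ j i, A j i ≤ 1)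
    (hd : ∀ j, 0 < A j j)
    (hX : ∀ j P i, f j (P + Pi.single (i, false) 1)
      = exp ((-(2 * Real.pi * A j i * P (i, true)) : ℝ) * I) * f j P)
    (hY : ∀ j P i, f j (P + Pi.single (i, true) 1) = f j P) :
    ∃ P, ∀ j, f j P = 0 := by
  by_contra! hno
  -- compact region
  set K : Set (Fin n × Bool → ℝ) := Set.Icc 0 (fun _ => 3) with hK
  have hKc : IsCompact K := isCompact_Icc
  have hKne : K.Nonempty := ⟨0, le_rfl, fun _ => by norm_num⟩
  let F : (Fin n × Bool → ℝ) → (Fin n → ℂ) := fun P j => f j P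
  have hF : Continuous F := continuous_pi hf
  obtain ⟨P0, hP0, hmin⟩ := hKc.exists_isMinOn hKne (hF.norm.continuousOn)
  set ε := ‖F P0‖ with hεdef
  have hε : 0 < ε := by
    rw [hεdef, norm_pos_iff]
    obtain ⟨j, hj⟩ := hno P0
    exact fun h => hj (congrFun h j)
  have hbig : ∀ P ∈ K, ∃ j, ε ≤ ‖f j P‖ := by
    intro P hP
    by_contra! hlt
    have h1 : ‖F P‖ < ε := (pi_norm_lt_iff hε).mpr hlt
    exact absurd (hmin hP) (not_le.mpr h1)
  obtain ⟨δ, hδ, hδarg⟩ : ∃ δ > 0, ∀ t : ℂ, ‖t - 1‖ < δ → |arg t| < Real.pi / 4 := by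
    have hc : ContinuousAt arg 1 := continuousAt_arg (by simp [slitPlane])
    obtain ⟨δ, hδ, h⟩ := Metric.continuousAt_iff.mp hc (Real.pi / 4) (by positivity)
    refine ⟨δ, hδ, fun t ht => ?_⟩
    have := h (x := t) (by rwa [dist_eq_norm])
    simpa [Real.dist_eq] using this
  obtain ⟨δ1, hδ1, huc1⟩ := Metric.uniformContinuousOn_iff.mp
    (hKc.uniformContinuousOn_of_continuous hF.continuousOn) (ε / 2) (by positivity)
  let Φ : (Fin n × Bool → ℝ) × ℝ → (Fin n → Fin n × Bool → ℂ) := fun p j μ =>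
    f j (p.1 + p.2 • Pi.single μ 1) * exp ((p.2 * conn (A j) μ p.1 : ℝ) * I)
  have hconn : ∀ j μ, Continuous (conn (A j) μ) := by
    intro j μ
    unfold conn
    split_ifs <;> fun_prop
  have hΦ : Continuous Φ := by
    refine continuous_pi fun j => continuous_pi fun μ => ?_
    have := hconn j μ
    have := hf j
    fun_prop
  obtain ⟨δ2, hδ2, huc2⟩ := Metric.uniformContinuousOn_iff.mp
    ((hKc.prod (isCompact_Icc (a := (0:ℝ)) (b := 1))).uniformContinuousOn_of_continuous
      hΦ.continuousOn) (ε / 2 * δ) (by positivity)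
  -- choose the mesh
  obtain ⟨M, hM1, hM2, hM3⟩ : ∃ M : ℕ, 2 * n + 4 ≤ M ∧ (1 : ℝ) / M < δ2 ∧ (2 * n + 2 : ℝ) / M < δ1 := by
    obtain ⟨M1, h1⟩ := exists_nat_gt (1 / δ2)
    obtain ⟨M2, h2⟩ := exists_nat_gt ((2 * n + 2 : ℝ) / δ1)
    have e1 : 0 < 1 / δ2 := by positivity
    have e2 : 0 < (2 * n + 2 : ℝ) / δ1 := by positivity
    refine ⟨2 * n + 4 + M1 + M2, by omega, ?_, ?_⟩
    · rw [div_lt_iff₀ (by positivity)]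
      rw [div_lt_iff₀ hδ2] at h1
      push_cast
      have : (0:ℝ) ≤ δ2 * (2 * n + 4 + M2) := by positivity
      nlinarith
    · rw [div_lt_iff₀ (by positivity)]
      rw [div_lt_iff₀ hδ1] at h2
      push_cast
      have : (0:ℝ) ≤ δ1 * (2 * n + 4 + M1) := by positivity
      nlinarith
  have hM0 : M ≠ 0 := by omega
  have hMr : (0 : ℝ) < M := by exact_mod_cast Nat.pos_of_ne_zero hM0
  have : NeZero M := ⟨hM0⟩
  have hper : ∀ j μ (x y : Fin n × Bool → ℤ), projL M x = projL M y →
      link M (f j) (A j) μ x = link M (f j) (A j) μ y := fun j μ x y hxy =>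
    periodic_all M _ (fun ν => link_periodic M hM0 (f j) (A j) (hX j) (hY j) μ ν) x y
      (fun κ => congrFun hxy κ)
  let lift : (Fin n × Bool → ZMod M) → (Fin n × Bool → ℤ) := fun x μ => ((x μ).val : ℤ)
  have hlift : ∀ x, projL M (lift x) = x := by
    intro x; funext μ; simp [projL, lift]
  let θ : Fin n → Fin n × Bool → (Fin n × Bool → ZMod M) → ℝ := fun j μ x =>
    arg (link M (f j) (A j) μ (lift x))
  have hθ : ∀ j μ z, θ j μ (projL M z) = arg (link M (f j) (A j) μ z) := by
    intro j μ z
    simp only [θ]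
    rw [hper j μ (lift (projL M z)) z (hlift _)]
  have hmain := cochain_main (Λ := ExteriorAlgebra ℝ ((Fin n × Bool) → ℝ))
    (fun μ : Fin n × Bool => (Pi.single μ 1 : Fin n × Bool → ZMod M)) eps eps_anti
    (fun j => curv M (A j)) θ (List.finRange n) (by
      intro x
      set z0 := lift x with hz0
      have hz0b : ∀ μ, 0 ≤ z0 μ ∧ z0 μ < M := by
        intro μ
        refine ⟨Int.natCast_nonneg _, ?_⟩
        simp only [hz0, lift]
        exact_mod_cast ZMod.val_lt (x μ)
      have hinK : ∀ z : Fin n × Bool → ℤ, (∀ μ, z0 μ ≤ z μ ∧ z μ ≤ z0 μ + 2 * n + 2) → pt M z ∈ K := by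
        intro z hz
        refine ⟨fun μ => ?_, fun μ => ?_⟩
        · have : (0:ℝ) ≤ z μ := by exact_mod_cast (hz0b μ).1.trans (hz μ).1
          simp only [pt, Pi.zero_apply]; positivity
        · simp only [pt]
          rw [div_le_iff₀ hMr]
          have h1 := (hz μ).2
          have h2 := (hz0b μ).2
          have h3 : z μ ≤ 3 * M := by omega
          exact_mod_cast h3
      obtain ⟨j, hj⟩ := hbig (pt M z0) (hinK z0 (fun μ => ⟨le_rfl, by omega⟩))
      have hnz : ∀ z : Fin n × Bool → ℤ, (∀ μ, z0 μ ≤ z μ ∧ z μ ≤ z0 μ + 2 * n + 2) →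
          ε / 2 < ‖f j (pt M z)‖ := by
        intro z hz
        have hdist : dist (pt M z0) (pt M z) < δ1 := by
          refine lt_of_le_of_lt ?_ hM3
          rw [dist_pi_le_iff (by positivity)]
          intro μ
          rw [Real.dist_eq]
          simp only [pt]
          rw [← sub_div, abs_div, abs_of_pos hMr]
          gcongr
          rw [abs_le]
          have h1 : (z0 μ : ℝ) ≤ z μ := by exact_mod_cast (hz μ).1
          have h2 : (z μ : ℝ) ≤ z0 μ + 2 * n + 2 := by exact_mod_cast (hz μ).2
          constructor <;> linarith
        have h1 := huc1 _ (hinK z0 (fun μ => ⟨le_rfl, by omega⟩)) _ (hinK z hz) hdist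
        have h2 := lt_of_le_of_lt (dist_le_pi_dist (F (pt M z0)) (F (pt M z)) j) h1
        rw [dist_eq_norm] at h2
        have h3 := norm_sub_norm_le (F (pt M z0) j) (F (pt M z) j)
        simp only [F] at h2 h3
        linarith
      have harg : ∀ z : Fin n × Bool → ℤ, (∀ μ, z0 μ ≤ z μ ∧ z μ ≤ z0 μ + 2 * n + 2) →
          ∀ μ, |arg (link M (f j) (A j) μ z)| < Real.pi / 4 := by
        intro z hz μ
        apply hδarg
        have h1 := hnz z hz
        have hne : f j (pt M z) ≠ 0 := by
          rw [← norm_pos_iff]; linarith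
        have hM4 : (1:ℝ) ≤ M := by exact_mod_cast Nat.one_le_iff_ne_zero.mpr hM0
        have h2 := huc2 (pt M z, 1 / M) ⟨hinK z hz, by positivity, by
          rw [div_le_one hMr]; exact hM4⟩ (pt M z, 0) ⟨hinK z hz, by simp⟩ (by
            rw [Prod.dist_eq]
            simp only [dist_self, Real.dist_eq, sub_zero]
            rw [abs_of_pos (by positivity)]
            exact max_lt hδ2 hM2)
        have h3 := lt_of_le_of_lt ((dist_le_pi_dist (Φ (pt M z, 1 / M) j) (Φ (pt M z, 0) j) μ).trans
          (dist_le_pi_dist (Φ (pt M z, 1 / M)) (Φ (pt M z, 0)) j)) h2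
        simp only [Φ, zero_smul, add_zero, zero_mul, ofReal_zero, exp_zero, mul_one] at h3
        have h4 : pt M z + (1 / M : ℝ) • Pi.single μ 1 = pt M (z + Pi.single μ 1) := by
          funext κ
          by_cases hκ : κ = μ
          · subst hκ; simp [pt]; ring
          · simp [pt, hκ]
        rw [h4, dist_eq_norm] at h3
        unfold link
        rw [div_sub_one hne, norm_div, div_lt_iff₀ (by linarith)]
        nlinarith
      refine ⟨j, List.mem_finRange j, ?_⟩
      intro y hy μ ν
      rw [← hlift x, ← hz0, List.length_finRange] at hy
      obtain ⟨z, rfl, hz⟩ := reach_proj M n _ y hy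
      have hs : ∀ κ τ : Fin n × Bool, (0 : ℤ) ≤ (Pi.single κ 1 : Fin n × Bool → ℤ) τ ∧ (Pi.single κ 1 : Fin n × Bool → ℤ) τ ≤ 1 := by
        intro κ τ
        by_cases h : τ = κ
        · subst h; simp
        · simp [h]
      have r0 : ∀ κ, z0 κ ≤ z κ ∧ z κ ≤ z0 κ + 2 * n + 2 := fun κ => by
        have := hz κ; constructor <;> omega
      have r1 : ∀ τ κ, z0 κ ≤ (z + Pi.single τ 1 : Fin n × Bool → ℤ) κ ∧ (z + Pi.single τ 1 : Fin n × Bool → ℤ) κ ≤ z0 κ + 2 * n + 2 := fun τ κ => by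
        have := hz κ; have := hs τ κ; simp only [Pi.add_apply]; constructor <;> omega
      have r2 : ∀ κ, z0 κ ≤ (z + Pi.single μ 1 + Pi.single ν 1 : Fin n × Bool → ℤ) κ ∧ (z + Pi.single μ 1 + Pi.single ν 1 : Fin n × Bool → ℤ) κ ≤ z0 κ + 2 * n + 2 := fun κ => by
        have := hz κ; have := hs μ κ; have := hs ν κ; simp only [Pi.add_apply]; constructor <;> omega
      have nz : ∀ z : Fin n × Bool → ℤ, (∀ μ, z0 μ ≤ z μ ∧ z μ ≤ z0 μ + 2 * n + 2) → f j (pt M z) ≠ 0 := by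
        intro z hz
        have := hnz z hz
        rw [← norm_pos_iff]; linarith
      simp only [projL_add, hθ]
      exact link_plaquette M (by omega) (f j) (A j) (hA0 j) (hA1 j) μ ν z (nz _ r0) (nz _ (r1 μ))
        (nz _ (r1 ν)) (nz _ r2) (harg _ (r1 μ) ν) (harg _ r0 ν) (harg _ (r1 ν) μ) (harg _ r0 μ))
  have hcurv : ∀ j, (∑ μ, ∑ ν, curv M (A j) μ ν • (eps μ * eps ν))
      = ∑ i, (2 * Real.pi / (M : ℝ) ^ 2 * A j i) • eta i := by
    intro j
    rw [Finset.sum_comm, Fintype.sum_prod_type]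
    refine Finset.sum_congr rfl fun i _ => ?_
    rw [Fintype.sum_bool, Finset.sum_eq_single (i, false)]
    · simp [curv, eta]
      ring_nf
    · intro μ _ hμ
      simp [curv, hμ]
    · simp
  simp only [hcurv] at hmain
  have hpi := Real.pi_pos
  exact prod_sum_eta_ne (fun j i => 2 * Real.pi / (M : ℝ) ^ 2 * A j i)
    (fun j i => mul_nonneg (by positivity) (hA0 j i))
    (fun j => mul_pos (by positivity) (hd j)) hmain

end Core
end BottAux

namespace BottAux
section Hopf
open Complex

/-- A nowhere zero quasi-periodic map to `ℂ²`. -/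
noncomputable def zetaAux (x s : ℝ) : Fin 2 → ℂ :=
  ![exp ((2 * Real.pi * x * s : ℝ) * I) * ((1 - s) + s * exp ((-(2 * Real.pi * x) : ℝ) * I)),
    exp ((2 * Real.pi * x * s : ℝ) * I) * (s * (1 - s))]

/-- A nowhere zero quasi-periodic map to `ℂ²`. -/
noncomputable def zeta (x y : ℝ) : Fin 2 → ℂ := zetaAux x (Int.fract y)

lemma zeta_ne (x y : ℝ) : zeta x y ≠ 0 := by
  intro h
  have h0 := congrFun h 0
  have h1 := congrFun h 1
  simp only [zeta, zetaAux, cons_val_zero, cons_val_one, Pi.zero_apply, mul_eq_zero,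
    exp_ne_zero, false_or] at h0 h1
  rcases h1 with h1 | h1
  · rw [h1] at h0; simp at h0
  · have h2 : Int.fract y = 1 := by
      have : (1 : ℂ) = Int.fract y := sub_eq_zero.mp h1
      exact_mod_cast this.symm
    exact absurd h2 (Int.fract_lt_one y).ne

lemma zeta_Y (x y : ℝ) : zeta x (y + 1) = zeta x y := by
  simp [zeta]

lemma exp_two_pi_int (k : ℤ) : exp ((2 * Real.pi * k : ℝ) * I) = 1 := by
  rw [exp_eq_one_iff]
  exact ⟨k, by push_cast; ring⟩

lemma zeta_X (x y : ℝ) : zeta (x + 1) y = exp ((2 * Real.pi * y : ℝ) * I) • zeta x y := by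
  have e1 : exp ((2 * Real.pi * (x + 1) * Int.fract y : ℝ) * I)
      = exp ((2 * Real.pi * y : ℝ) * I) * exp ((2 * Real.pi * x * Int.fract y : ℝ) * I) := by
    rw [← exp_add, ← mul_one (exp (_ + _)), ← exp_two_pi_int (-⌊y⌋), ← exp_add, ← add_mul,
      ← add_mul, ← ofReal_add, ← ofReal_add]
    congr 3
    have := Int.floor_add_fract y
    push_cast
    linear_combination (2 * Real.pi) * this
  have e2 : exp ((-(2 * Real.pi * (x + 1)) : ℝ) * I) = exp ((-(2 * Real.pi * x) : ℝ) * I) := by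
    rw [← mul_one (exp ((-(2 * Real.pi * x) : ℝ) * I)), ← exp_two_pi_int (-1), ← exp_add, ← add_mul,
      ← ofReal_add]
    congr 3
    push_cast
    ring
  funext k
  fin_cases k
  · simp only [zeta, zetaAux, e1, e2, Pi.smul_apply, smul_eq_mul]
    simp [mul_assoc]
  · simp only [zeta, zetaAux, e1, e2, Pi.smul_apply, smul_eq_mul]
    simp [mul_assoc]

lemma continuous_zeta : Continuous fun p : ℝ × ℝ => zeta p.1 p.2 := by
  have h : ContinuousOn (Function.uncurry fun (p : ℝ × ℝ) (s : ℝ) => zetaAux p.1 s)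
      (Set.univ ×ˢ Set.Icc 0 1) := by
    apply Continuous.continuousOn
    refine continuous_pi fun k => ?_
    fin_cases k
    · simp only [zetaAux, Function.uncurry]
      simp
      fun_prop
    · simp only [zetaAux, Function.uncurry]
      simp
      fun_prop
  refine ContinuousOn.comp_fract (s := fun p : ℝ × ℝ => p.2) h continuous_snd ?_
  intro p
  funext k
  fin_cases k
  · simp [zetaAux, ← exp_add]
  · simp [zetaAux]

/-- squared norm -/
noncomputable def nrm (z : Fin 2 → ℂ) : ℝ := normSq (z 0) + normSq (z 1)

lemma nrm_pos {z : Fin 2 → ℂ} (hz : z ≠ 0) : 0 < nrm z := by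
  by_contra h
  have h0 := normSq_nonneg (z 0)
  have h1 := normSq_nonneg (z 1)
  unfold nrm at h
  have h0' : normSq (z 0) = 0 := by linarith
  have h1' : normSq (z 1) = 0 := by linarith
  apply hz
  funext k
  fin_cases k
  · exact normSq_eq_zero.mp h0'
  · exact normSq_eq_zero.mp h1'

/-- The Hopf map in coordinates. -/
noncomputable def hopfVec (z : Fin 2 → ℂ) : EuclideanSpace ℝ (Fin 3) :=
  !₂[2 * (z 0 * (starRingEnd ℂ) (z 1)).re / nrm z, -2 * (z 0 * (starRingEnd ℂ) (z 1)).im / nrm z,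
    (normSq (z 0) - normSq (z 1)) / nrm z]

lemma hopfVec_mem {z : Fin 2 → ℂ} (hz : z ≠ 0) :
    hopfVec z ∈ Metric.sphere (0 : EuclideanSpace ℝ (Fin 3)) 1 := by
  have hr := nrm_pos hz
  rw [mem_sphere_zero_iff_norm, EuclideanSpace.norm_eq, Real.sqrt_eq_one, Fin.sum_univ_three]
  simp only [hopfVec, Real.norm_eq_abs, sq_abs]
  simp
  field_simp
  simp only [nrm, normSq_apply]
  ring

/-- The Hopf map. -/
noncomputable def hopf (z : Fin 2 → ℂ) : TwoSphere :=
  if hz : z ≠ 0 then ⟨hopfVec z, hopfVec_mem hz⟩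
  else ⟨hopfVec ![1, 0], hopfVec_mem (by intro h; simpa using congrFun h 0)⟩

lemma hopf_val {z : Fin 2 → ℂ} (hz : z ≠ 0) : (hopf z).1 = hopfVec z := by
  simp [hopf, hz]

lemma hopf_smul (c : ℂ) (hc : c ≠ 0) {z : Fin 2 → ℂ} (hz : z ≠ 0) : hopf (c • z) = hopf z := by
  apply Subtype.ext
  rw [hopf_val hz, hopf_val (smul_ne_zero hc hz)]
  have hr := nrm_pos hz
  have hc' : 0 < normSq c := normSq_pos.mpr hc
  have e : nrm (c • z) = normSq c * nrm z := by simp [nrm]; ring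
  have e2 : (c • z) 0 * (starRingEnd ℂ) ((c • z) 1) = normSq c * (z 0 * (starRingEnd ℂ) (z 1)) := by
    rw [normSq_eq_conj_mul_self]; simp; ring
  unfold hopfVec
  rw [e, e2]
  congr 1
  funext k
  fin_cases k
  · simp; field_simp
  · simp; field_simp
  · simp; field_simp

lemma bott_hopf {z : Fin 2 → ℂ} (hz : z ≠ 0) (a b : Fin 2) :
    bott (hopf z) a b = z a * (starRingEnd ℂ) (z b) / nrm z := by
  have hr := nrm_pos hz
  have hr' : (nrm z : ℂ) ≠ 0 := by exact_mod_cast hr.ne'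
  unfold bott
  rw [hopf_val hz]
  have hn : (nrm z : ℂ) = z 0 * (starRingEnd ℂ) (z 0) + z 1 * (starRingEnd ℂ) (z 1) := by
    simp [nrm, mul_conj]
  apply Complex.ext
  · fin_cases a <;> fin_cases b <;> simp [hopfVec, div_ofReal_re] <;> field_simp <;>
      simp [nrm, normSq_apply] <;> ring
  · fin_cases a <;> fin_cases b <;> simp [hopfVec, div_ofReal_im] <;> field_simp <;>
      simp [nrm, normSq_apply] <;> ring

lemma continuousOn_hopf : ContinuousOn hopf {z | z ≠ 0} := by
  rw [continuousOn_iff_continuous_domRestrict]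
  refine Continuous.subtype_mk (p := fun x => x ∈ Metric.sphere (0 : EuclideanSpace ℝ (Fin 3)) 1) (f := fun z : {z : Fin 2 → ℂ | z ≠ 0} => hopfVec z.1) ?_ (fun z => hopfVec_mem z.2) |>.congr ?_
  · refine (PiLp.continuous_toLp 2 _).comp (continuous_pi fun k => ?_)
    have h0 : Continuous fun z : {z : Fin 2 → ℂ | z ≠ 0} => z.1 0 :=
      (continuous_apply 0).comp continuous_subtype_val
    have h1 : Continuous fun z : {z : Fin 2 → ℂ | z ≠ 0} => z.1 1 :=
      (continuous_apply 1).comp continuous_subtype_val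
    have hn : Continuous fun z : {z : Fin 2 → ℂ | z ≠ 0} => nrm z.1 :=
      (continuous_normSq.comp h0).add (continuous_normSq.comp h1)
    have hne : ∀ z : {z : Fin 2 → ℂ | z ≠ 0}, nrm z.1 ≠ 0 := fun z => (nrm_pos z.2).ne'
    have h2 := h0.mul (Complex.continuous_conj.comp h1)
    fin_cases k
    · exact Continuous.div (continuous_const.mul (continuous_re.comp h2)) hn hne
    · exact Continuous.div (continuous_const.mul (continuous_im.comp h2)) hn hne
    · exact Continuous.div ((continuous_normSq.comp h0).sub (continuous_normSq.comp h1)) hn hne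
  · intro z
    apply Subtype.ext
    exact (hopf_val z.2).symm

/-- Existence of zeros for equivariant maps. -/
theorem equivariant_zero {n : ℕ} {ι : Type*} [Fintype ι] [DecidableEq ι] (I' : Fin n → Finset ι)
    (σ : Fin n → ι) (hσ : Function.Injective σ) (hσI : ∀ j, σ j ∈ I' j)
    (F : Fin n → (ι → Fin 2 → ℂ) → ℂ)
    (hF : ∀ j, ContinuousOn (F j) {Z | ∀ i, Z i ≠ 0})
    (heq : ∀ j (c : ι → ℂ) (Z : ι → Fin 2 → ℂ), (∀ i, c i ≠ 0) → (∀ i, Z i ≠ 0) →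
      F j (fun i => c i • Z i) = (∏ i ∈ I' j, (starRingEnd ℂ) (c i)) * F j Z) :
    ∃ Z : ι → Fin 2 → ℂ, (∀ i, Z i ≠ 0) ∧ ∀ j, F j Z = 0 := by
  classical
  let Z : (Fin n × Bool → ℝ) → ι → Fin 2 → ℂ := fun P =>
    Function.extend σ (fun t => zeta (P (t, false)) (P (t, true))) (fun _ => ![1, 0])
  have hZσ : ∀ P t, Z P (σ t) = zeta (P (t, false)) (P (t, true)) := fun P t =>
    hσ.extend_apply _ _ _
  have hZo : ∀ P i, (¬ ∃ t, σ t = i) → Z P i = ![1, 0] := fun P i hi =>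
    Function.extend_apply' _ _ _ hi
  have hZne : ∀ P i, Z P i ≠ 0 := by
    intro P i
    by_cases h : ∃ t, σ t = i
    · obtain ⟨t, rfl⟩ := h
      rw [hZσ]; exact zeta_ne _ _
    · rw [hZo P i h]
      intro h; simpa using congrFun h 0
  have hZc : Continuous Z := by
    refine continuous_pi fun i => ?_
    by_cases h : ∃ t, σ t = i
    · obtain ⟨t, rfl⟩ := h
      simp only [hZσ]
      exact continuous_zeta.comp (by fun_prop : Continuous fun P : Fin n × Bool → ℝ => (P (t, false), P (t, true)))
    · simp only [fun P => hZo P i h]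
      exact continuous_const
  obtain ⟨P, hP⟩ := core (fun j P => F j (Z P))
    (fun j => (hF j).comp_continuous hZc (fun P => hZne P))
    (fun j t => if σ t ∈ I' j then 1 else 0) (fun j t => by split_ifs <;> norm_num)
    (fun j t => by split_ifs <;> norm_num) (fun j => by simp [hσI j])
    (by
      intro j P t
      have hZ : Z (P + Pi.single (t, false) 1) = fun i =>
          (if i = σ t then exp ((2 * Real.pi * P (t, true) : ℝ) * I) else 1) • Z P i := by
        funext i
        by_cases h : ∃ t', σ t' = i
        · obtain ⟨t', rfl⟩ := h
          rw [hZσ, hZσ]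
          by_cases ht : t' = t
          · subst ht
            simp only [if_true, Pi.add_apply, Pi.single_eq_same]
            rw [zeta_X]
            simp
          · have : σ t' ≠ σ t := fun h => ht (hσ h)
            simp [this, ht]
        · rw [hZo _ i h, hZo _ i h]
          have : i ≠ σ t := fun h' => h ⟨t, h'.symm⟩
          simp [this]
      rw [hZ, heq j _ _ (fun i => by split_ifs; exact exp_ne_zero _; exact one_ne_zero) (hZne P)]
      congr 1
      have : ∀ i, (starRingEnd ℂ) (if i = σ t then exp ((2 * Real.pi * P (t, true) : ℝ) * I) else 1)
          = if i = σ t then exp ((-(2 * Real.pi * P (t, true)) : ℝ) * I) else 1 := by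
        intro i
        split_ifs
        · rw [← exp_conj, map_mul, conj_I, conj_ofReal]; push_cast; ring_nf
        · simp
      rw [Finset.prod_congr rfl fun i _ => this i, Finset.prod_ite_eq']
      split_ifs
      · simp
      · simp)
    (by
      intro j P t
      congr 1
      funext i
      by_cases h : ∃ t', σ t' = i
      · obtain ⟨t', rfl⟩ := h
        rw [hZσ, hZσ]
        by_cases ht : t' = t
        · subst ht
          simp only [Pi.add_apply, Pi.single_eq_same]
          rw [zeta_Y]
          simp
        · simp [ht]
      · rw [hZo _ i h, hZo _ i h])
  exact ⟨Z P, hZne P, hP⟩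

end Hopf
end BottAux
namespace BottAux
section Neg
open Complex

lemma bott_conj (x : TwoSphere) (a b : Fin 2) : (starRingEnd ℂ) (bott x a b) = bott x b a := by
  apply Complex.ext <;> fin_cases a <;> fin_cases b <;> simp [bott]

lemma trivFactor_conj (a b : Fin 2) :
    (starRingEnd ℂ) (trivFactor a b) = trivFactor b a := by
  fin_cases a <;> fin_cases b <;> simp [trivFactor]

lemma bottProj_herm (N : ℕ) (I : Finset (Fin N)) (x : Fin N → TwoSphere) :
    (bottProj N I x)ᴴ = bottProj N I x := by
  ext a b
  simp only [conjTranspose_apply, bottProj, of_apply]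
  rw [← starRingEnd_apply, map_prod]
  refine Finset.prod_congr rfl fun i _ => ?_
  split_ifs
  · exact bott_conj _ _ _
  · exact trivFactor_conj _ _

lemma Q_herm (N n : ℕ) (I : Fin n → Finset (Fin N)) (x : Fin N → TwoSphere) :
    (Matrix.blockDiagonal fun j : Fin n => bottProj N (I j) x)ᴴ =
      Matrix.blockDiagonal fun j : Fin n => bottProj N (I j) x := by
  rw [blockDiagonal_conjTranspose]
  simp only [bottProj_herm]

/-- the spanning vector of the line bundle, pulled back along the Hopf maps -/
noncomputable def tens {N k : ℕ} (I : Finset (Fin N)) (Z : Fin N ⊕ Fin k → Fin 2 → ℂ)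
    (a : Fin N → Fin 2) : ℂ :=
  ∏ i, if i ∈ I then Z (Sum.inl i) (a i) else if a i = 0 then 1 else 0

lemma bottProj_hopf {N k : ℕ} (I : Finset (Fin N)) (Z : Fin N ⊕ Fin k → Fin 2 → ℂ)
    (hZ : ∀ i, Z i ≠ 0) : ∃ c : ℂ, ∀ a b,
    bottProj N I (fun i => hopf (Z (Sum.inl i))) a b
      = c * tens I Z a * (starRingEnd ℂ) (tens I Z b) := by
  refine ⟨∏ i, if i ∈ I then ((nrm (Z (Sum.inl i)) : ℂ))⁻¹ else 1, fun a b => ?_⟩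
  simp only [bottProj, of_apply, tens]
  rw [map_prod, ← Finset.prod_mul_distrib, ← Finset.prod_mul_distrib]
  refine Finset.prod_congr rfl fun i _ => ?_
  split_ifs <;> simp_all [bott_hopf, trivFactor]
  field_simp

lemma tens_smul {N k : ℕ} (I : Finset (Fin N)) (Z : Fin N ⊕ Fin k → Fin 2 → ℂ)
    (c : Fin N ⊕ Fin k → ℂ) (a : Fin N → Fin 2) :
    tens I (fun i => c i • Z i) a = (∏ i ∈ I, c (Sum.inl i)) * tens I Z a := by
  have : ∏ i ∈ I, c (Sum.inl i) = ∏ i, if i ∈ I then c (Sum.inl i) else 1 := by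
    rw [Finset.prod_ite_mem]; simp
  rw [this]
  unfold tens
  rw [← Finset.prod_mul_distrib]
  refine Finset.prod_congr rfl fun i _ => ?_
  split_ifs <;> simp

lemma continuous_tens {N k : ℕ} (I : Finset (Fin N)) (a : Fin N → Fin 2) :
    Continuous fun Z : Fin N ⊕ Fin k → Fin 2 → ℂ => tens I Z a := by
  unfold tens
  refine continuous_finsetProd _ fun i _ => ?_
  split_ifs
  · fun_prop
  · fun_prop
  · fun_prop

open Polynomial in
/-- product of linear forms -/
noncomputable def lpoly {N k : ℕ} (Z : Fin N ⊕ Fin k → Fin 2 → ℂ) : ℂ[X] :=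
  ∏ l : Fin k, (C ((starRingEnd ℂ) (Z (Sum.inr l) 0)) + C ((starRingEnd ℂ) (Z (Sum.inr l) 1)) * X)

open Polynomial in
lemma lpoly_smul {N k : ℕ} (Z : Fin N ⊕ Fin k → Fin 2 → ℂ) (c : Fin N ⊕ Fin k → ℂ) :
    lpoly (fun i => c i • Z i) = C (∏ l, (starRingEnd ℂ) (c (Sum.inr l))) * lpoly Z := by
  unfold lpoly
  rw [map_prod, ← Finset.prod_mul_distrib]
  refine Finset.prod_congr rfl fun i _ => ?_
  simp
  ring

open Polynomial in
lemma lpoly_ne {N k : ℕ} (Z : Fin N ⊕ Fin k → Fin 2 → ℂ) (hZ : ∀ i, Z i ≠ 0) :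
    lpoly Z ≠ 0 := by
  unfold lpoly
  rw [Finset.prod_ne_zero_iff]
  intro l _ h
  apply hZ (Sum.inr l)
  have h0 := congrArg (fun p => coeff p 0) h
  have h1 := congrArg (fun p => coeff p 1) h
  simp [coeff_C] at h0 h1
  funext t
  fin_cases t
  · exact h0
  · exact h1

open Polynomial in
lemma lpoly_natDegree {N k : ℕ} (Z : Fin N ⊕ Fin k → Fin 2 → ℂ) :
    (lpoly Z).natDegree ≤ k := by
  unfold lpoly
  refine (natDegree_prod_le _ _).trans ?_
  refine (Finset.sum_le_card_nsmul _ _ 1 fun l _ => ?_).trans (by simp)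
  compute_degree

open Polynomial in
lemma continuous_lpoly {N k : ℕ} (q : ℕ) :
    Continuous fun Z : Fin N ⊕ Fin k → Fin 2 → ℂ => (lpoly Z).coeff q := by
  unfold lpoly
  generalize (Finset.univ : Finset (Fin k)) = s
  induction s using Finset.induction_on generalizing q with
  | empty => simp only [Finset.prod_empty]; exact continuous_const
  | insert l s hl ih =>
    simp only [Finset.prod_insert hl, coeff_mul]
    refine continuous_finsetSum _ fun p _ => Continuous.mul ?_ (ih _)
    have h0 : Continuous fun Z : Fin N ⊕ Fin k → Fin 2 → ℂ =>
        (starRingEnd ℂ) (Z (Sum.inr l) 0) := Complex.continuous_conj.comp (by fun_prop)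
    have h1 : Continuous fun Z : Fin N ⊕ Fin k → Fin 2 → ℂ =>
        (starRingEnd ℂ) (Z (Sum.inr l) 1) := Complex.continuous_conj.comp (by fun_prop)
    simp only [coeff_add, coeff_C, coeff_C_mul, coeff_X]
    refine Continuous.add ?_ (h1.mul continuous_const)
    split_ifs
    · exact h0
    · exact continuous_const

theorem neg_direction (N n m : ℕ) (I : Fin n → Finset (Fin N))
    (hH : ∀ F : Finset (Fin n), F.card < (F.biUnion I).card + m) :
    ¬ CSubequiv (fun _ : Fin N → TwoSphere => (1 : Matrix (Fin m) (Fin m) ℂ))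
        (fun x => Matrix.blockDiagonal fun j : Fin n => bottProj N (I j) x) := by
  classical
  rintro ⟨v, hvc, hv⟩
  have hm : 0 < m := by simpa using hH ∅
  obtain ⟨k, rfl⟩ : ∃ k, m = k + 1 := ⟨m - 1, by omega⟩
  have hQv : ∀ x, (Matrix.blockDiagonal fun j : Fin n => bottProj N (I j) x) * v x = v x := by
    intro x
    obtain ⟨h1, h2⟩ := hv x
    have h3 := congrArg conjTranspose h2
    simp only [conjTranspose_mul, conjTranspose_conjTranspose] at h3
    rw [Q_herm] at h3
    have h4 := congrArg (· * v x) h3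
    simp only [Matrix.mul_assoc, h1, Matrix.mul_one] at h4
    exact h4
  let I' : Fin n → Finset (Fin N ⊕ Fin k) := fun j => (I j).disjSum Finset.univ
  have hall : ∀ F : Finset (Fin n), F.card ≤ (F.biUnion I').card := by
    intro F
    rcases F.eq_empty_or_nonempty with rfl | ⟨j0, hj0⟩
    · simp
    · have : F.biUnion I' = (F.biUnion I).disjSum Finset.univ := by
        ext i
        rcases i with i | l
        · simp [I']
        · simp [I']; exact ⟨j0, hj0⟩
      rw [this, Finset.card_disjSum, Finset.card_univ, Fintype.card_fin]
      have := hH F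
      omega
  obtain ⟨σ, hσ, hσI⟩ := (Finset.all_card_le_biUnion_card_iff_exists_injective I').mp hall
  let xx : (Fin N ⊕ Fin k → Fin 2 → ℂ) → Fin N → TwoSphere := fun Z i => hopf (Z (Sum.inl i))
  obtain ⟨Z, hZ, hZ0⟩ := equivariant_zero I' σ hσ hσI
    (fun j Z => ∑ q : Fin (k + 1), (lpoly Z).coeff q *
      ∑ a, (starRingEnd ℂ) (tens (I j) Z a) * v (xx Z) (a, j) q)
    (by
      intro j
      have hx : ContinuousOn xx {Z | ∀ i, Z i ≠ 0} := by
        refine continuousOn_pi.mpr fun i => ?_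
        exact continuousOn_hopf.comp (by fun_prop) (fun Z hZ => hZ _)
      have hvx := hvc.comp_continuousOn hx
      refine continuousOn_finsetSum _ fun q _ => ContinuousOn.mul
        (continuous_lpoly _).continuousOn (continuousOn_finsetSum _ fun a _ => ContinuousOn.mul
        (Complex.continuous_conj.comp (continuous_tens _ _)).continuousOn ?_)
      exact ((continuous_apply q).comp (continuous_apply (a, j))).comp_continuousOn hvx)
    (by
      intro j c Z hc hZ
      have hxx : xx (fun i => c i • Z i) = xx Z := by
        funext i
        exact hopf_smul _ (hc _) (hZ _)
      have hp : ∏ i ∈ I' j, (starRingEnd ℂ) (c i) =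
          (∏ i ∈ I j, (starRingEnd ℂ) (c (Sum.inl i))) * ∏ l, (starRingEnd ℂ) (c (Sum.inr l)) :=
        Finset.prod_disjSum _ _ _
      simp only [hxx, tens_smul, lpoly_smul, hp, Polynomial.coeff_C_mul]
      simp only [map_mul, map_prod, Finset.mul_sum]
      refine Finset.sum_congr rfl fun q _ => Finset.sum_congr rfl fun a _ => ?_
      ring)
  let w : Fin (k + 1) → ℂ := fun q => (lpoly Z).coeff q
  have hu : v (xx Z) *ᵥ w = 0 := by
    rw [← hQv, ← mulVec_mulVec]
    funext p
    obtain ⟨a, j⟩ := p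
    obtain ⟨c, hc⟩ := bottProj_hopf (I j) Z hZ
    have h0 := hZ0 j
    simp only [Pi.zero_apply]
    rw [mulVec, dotProduct, Fintype.sum_prod_type]
    simp only [blockDiagonal_apply, ite_mul, zero_mul, Finset.sum_ite_eq, Finset.mem_univ, if_true]
    have : ∀ b, bottProj N (I j) (xx Z) a b * (v (xx Z) *ᵥ w) (b, j) = c * tens (I j) Z a *
        ((starRingEnd ℂ) (tens (I j) Z b) * (v (xx Z) *ᵥ w) (b, j)) := by
      intro b
      rw [hc a b]; ring
    rw [Finset.sum_congr rfl fun b _ => this b, ← Finset.mul_sum]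
    convert mul_zero _
    rw [← h0]
    simp only [mulVec, dotProduct, Finset.mul_sum]
    rw [Finset.sum_comm]
    refine Finset.sum_congr rfl fun q _ => Finset.sum_congr rfl fun b _ => ?_
    simp only [w]
    ring
  have hw : w = 0 := by
    have := congrArg (fun u => (v (xx Z))ᴴ *ᵥ u) hu
    simpa [mulVec_mulVec, (hv (xx Z)).1] using this
  apply lpoly_ne Z hZ
  ext q
  by_cases hq : q < k + 1
  · exact congrFun hw ⟨q, hq⟩
  · rw [Polynomial.coeff_zero]
    exact Polynomial.coeff_eq_zero_of_natDegree_lt (by have := lpoly_natDegree Z; omega)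

end Neg
end BottAux
namespace BottAux
section Pos
open Complex

lemma continuous_coord (k : Fin 3) : Continuous fun x : TwoSphere => ((x.1 k : ℝ) : ℂ) := by
  have h : Continuous fun x : TwoSphere => x.1 := continuous_subtype_val
  exact continuous_ofReal.comp ((EuclideanSpace.proj (𝕜 := ℝ) k).continuous.comp h)

lemma continuous_bott : Continuous bott := by
  have h0 := continuous_coord 0
  have h1 := continuous_coord 1
  have h2 := continuous_coord 2
  refine continuous_pi fun a => continuous_pi fun b => ?_
  fin_cases a <;> fin_cases b <;> simp [bott]
  · exact continuous_const.mul (continuous_const.add h2)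
  · exact continuous_const.mul (h0.sub (h1.mul continuous_const))
  · exact continuous_const.mul (h0.add (h1.mul continuous_const))
  · exact continuous_const.mul (continuous_const.sub h2)

lemma bott_idem (x : TwoSphere) : bott x * bott x = bott x := by
  have h : (x.1 0) ^ 2 + (x.1 1) ^ 2 + (x.1 2) ^ 2 = 1 := by
    have := mem_sphere_zero_iff_norm.mp x.2
    rw [EuclideanSpace.norm_eq, Real.sqrt_eq_one, Fin.sum_univ_three] at this
    simpa only [Real.norm_eq_abs, sq_abs] using this
  have h' : ((x.1 0 : ℝ) : ℂ) ^ 2 + ((x.1 1 : ℝ) : ℂ) ^ 2 + ((x.1 2 : ℝ) : ℂ) ^ 2 = 1 := by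
    have h2 := congrArg (fun t : ℝ => (t : ℂ)) h
    simpa only [ofReal_add, ofReal_pow, ofReal_one] using h2
  have hI := Complex.I_sq
  unfold bott
  generalize ((x.1 0 : ℝ) : ℂ) = p at *
  generalize ((x.1 1 : ℝ) : ℂ) = q at *
  generalize ((x.1 2 : ℝ) : ℂ) = r at *
  ext a b
  fin_cases a <;> fin_cases b <;> simp [Matrix.mul_apply, Fin.sum_univ_two] 
  · linear_combination (1/4) * h' - (1/4) * q^2 * hI
  · ring
  · ring
  · linear_combination (1/4) * h' - (1/4) * q^2 * hI

lemma trivFactor_idem : trivFactor * trivFactor = trivFactor := by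
  ext a b
  fin_cases a <;> fin_cases b <;> simp [Matrix.mul_apply, trivFactor]

lemma bottProj_idem (N : ℕ) (I : Finset (Fin N)) (x : Fin N → TwoSphere) :
    bottProj N I x * bottProj N I x = bottProj N I x := by
  ext a c
  simp only [Matrix.mul_apply, bottProj, of_apply, ← Finset.prod_mul_distrib]
  have := (Finset.prod_univ_sum (fun _ : Fin N => (Finset.univ : Finset (Fin 2)))
    (fun i t => (if i ∈ I then bott (x i) else trivFactor) (a i) t *
      (if i ∈ I then bott (x i) else trivFactor) t (c i)))
  rw [Fintype.piFinset_univ] at this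
  rw [← this]
  refine Finset.prod_congr rfl fun i _ => ?_
  rw [← Matrix.mul_apply]
  split_ifs
  · rw [bott_idem]
  · rw [trivFactor_idem]

lemma continuous_bottProj (N : ℕ) (I : Finset (Fin N)) : Continuous (bottProj N I) := by
  refine continuous_pi fun a => continuous_pi fun b => ?_
  simp only [bottProj, of_apply]
  refine continuous_finsetProd _ fun i _ => ?_
  split_ifs
  · exact ((continuous_apply (b i)).comp (continuous_apply (a i))).comp
      (continuous_bott.comp
        (continuous_apply i : Continuous fun x : Fin N → TwoSphere => x i))
  · exact continuous_const

/-- constant sections -/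
def wv (α : ℂ) : Fin 2 → ℂ := ![1, α]

lemma bott_wv (x : TwoSphere) {α β : ℂ} (h1 : bott x *ᵥ wv α = 0) (h2 : bott x *ᵥ wv β = 0) :
    α = β := by
  by_contra hne
  have ht : bott x 0 0 + bott x 1 1 = 1 := by
    simp [bott]; ring
  have key : ∀ a, bott x a 0 = 0 ∧ bott x a 1 = 0 := by
    intro a
    have e1 := congrFun h1 a
    have e2 := congrFun h2 a
    simp [mulVec, dotProduct, Fin.sum_univ_two, wv] at e1 e2
    have e3 : bott x a 1 * (α - β) = 0 := by linear_combination e1 - e2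
    have e4 : bott x a 1 = 0 := (mul_eq_zero.mp e3).resolve_right (sub_ne_zero.mpr hne)
    exact ⟨by simpa [e4] using e1, e4⟩
  rw [(key 0).1, (key 1).2] at ht
  simp at ht

/-- section of the line bundle -/
noncomputable def sec {N : ℕ} (I : Finset (Fin N)) (α : ℂ) (x : Fin N → TwoSphere) :
    (Fin N → Fin 2) → ℂ :=
  bottProj N I x *ᵥ fun b => ∏ i, wv α (b i)

lemma sec_ne {N : ℕ} (I : Finset (Fin N)) (α : ℂ) (x : Fin N → TwoSphere)
    (h : ∀ i ∈ I, bott (x i) *ᵥ wv α ≠ 0) : ∃ a, sec I α x a ≠ 0 := by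
  have e : ∀ a, sec I α x a =
      ∏ i, ((if i ∈ I then bott (x i) else trivFactor) *ᵥ wv α) (a i) := by
    intro a
    simp only [sec, mulVec, dotProduct, bottProj, of_apply, ← Finset.prod_mul_distrib]
    have := (Finset.prod_univ_sum (fun _ : Fin N => (Finset.univ : Finset (Fin 2)))
      (fun i t => (if i ∈ I then bott (x i) else trivFactor) (a i) t * wv α t))
    rw [Fintype.piFinset_univ] at this
    rw [← this]
  have h' : ∀ i, ∃ t, ((if i ∈ I then bott (x i) else trivFactor) *ᵥ wv α) t ≠ 0 := by
    intro i
    split_ifs with hi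
    · by_contra hc
      push Not at hc
      exact h i hi (funext hc)
    · exact ⟨0, by simp [mulVec, dotProduct, wv, trivFactor]⟩
  choose a ha using h'
  exact ⟨a, by rw [e]; exact Finset.prod_ne_zero_iff.mpr fun i _ => ha i⟩

lemma exists_orthonormal {X E : Type*} [TopologicalSpace X] [NormedAddCommGroup E]
    [InnerProductSpace ℂ E] {m : ℕ} (f : X → Fin m → E) (hf : ∀ q, Continuous fun x => f x q)
    (hl : ∀ x, LinearIndependent ℂ (f x)) :
    ∃ g : X → Fin m → E, (∀ q, Continuous fun x => g x q) ∧ (∀ x, Orthonormal ℂ (g x)) ∧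
      ∀ x q, g x q ∈ Submodule.span ℂ (Set.range (f x)) := by
  open InnerProductSpace in
  have hc : ∀ q, Continuous fun x => gramSchmidt ℂ (f x) q := by
    intro q
    induction q using WellFoundedLT.induction with
    | ind q ih =>
      have : (fun x => gramSchmidt ℂ (f x) q) = fun x => f x q - ∑ i ∈ Finset.Iio q,
          (inner ℂ (gramSchmidt ℂ (f x) i) (f x q) / ((‖gramSchmidt ℂ (f x) i‖ : ℝ) : ℂ) ^ 2) •
            gramSchmidt ℂ (f x) i := by
        funext x
        exact eq_sub_of_add_eq (gramSchmidt_def'' ℂ (f x) q).symm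
      rw [this]
      refine (hf q).sub (continuous_finsetSum _ fun i hi => ?_)
      have hi' := ih i (Finset.mem_Iio.mp hi)
      refine Continuous.smul (Continuous.div (hi'.inner (hf q))
        ((continuous_ofReal.comp hi'.norm).pow 2) fun x => ?_) hi'
      have := gramSchmidt_ne_zero (𝕜 := ℂ) i (hl x)
      simpa using this
  refine ⟨fun x => InnerProductSpace.gramSchmidtNormed ℂ (f x), fun q => ?_,
    fun x => InnerProductSpace.gramSchmidtNormed_orthonormal (hl x), fun x q => ?_⟩
  · unfold InnerProductSpace.gramSchmidtNormed
    refine Continuous.smul (Continuous.inv₀ (continuous_ofReal.comp (hc q).norm) fun x => ?_) (hc q)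
    have := InnerProductSpace.gramSchmidt_ne_zero (𝕜 := ℂ) q (hl x)
    simpa using this
  · rw [← InnerProductSpace.span_gramSchmidt ℂ (f x),
      ← InnerProductSpace.span_gramSchmidtNormed_range]
    exact Submodule.subset_span ⟨q, rfl⟩

theorem pos_direction (N n m : ℕ) (I : Fin n → Finset (Fin N))
    (F : Finset (Fin n)) (hF : (F.biUnion I).card + m ≤ F.card) :
    CSubequiv (fun _ : Fin N → TwoSphere => (1 : Matrix (Fin m) (Fin m) ℂ))
        (fun x => Matrix.blockDiagonal fun j : Fin n => bottProj N (I j) x) := by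
  classical
  let α : Fin n → ℂ := fun j => ((j : ℕ) : ℂ)
  have hα : Function.Injective α := fun a b h => Fin.ext (Nat.cast_injective h)
  let Q : (Fin N → TwoSphere) → Matrix ((Fin N → Fin 2) × Fin n) ((Fin N → Fin 2) × Fin n) ℂ :=
    fun x => Matrix.blockDiagonal fun j : Fin n => bottProj N (I j) x
  let s : (Fin N → TwoSphere) → Fin m → ((Fin N → Fin 2) × Fin n) → ℂ := fun x q p =>
    α p.2 ^ (q : ℕ) * if p.2 ∈ F then sec (I p.2) (α p.2) x p.1 else 0
  have hQs : ∀ x q, Q x *ᵥ s x q = s x q := by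
    intro x q
    funext p
    obtain ⟨a, j⟩ := p
    simp only [mulVec, dotProduct, Q]
    rw [Fintype.sum_prod_type]
    simp only [blockDiagonal_apply, ite_mul, zero_mul, Finset.sum_ite_eq, Finset.mem_univ, if_true]
    simp only [s]
    split_ifs
    · have : bottProj N (I j) x *ᵥ sec (I j) (α j) x = sec (I j) (α j) x := by
        simp only [sec, mulVec_mulVec, bottProj_idem]
      rw [← congrFun this a]
      simp only [mulVec, dotProduct, Finset.mul_sum]
      refine Finset.sum_congr rfl fun b _ => ?_
      ring
    · simp
  have hsc : ∀ q p, Continuous fun x => s x q p := by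
    intro q p
    simp only [s]
    refine continuous_const.mul ?_
    split_ifs
    · simp only [sec, mulVec, dotProduct]
      refine continuous_finsetSum _ fun b _ => Continuous.mul ?_ continuous_const
      exact ((continuous_apply b).comp (continuous_apply p.1)).comp (continuous_bottProj N _)
    · exact continuous_const
  let f : (Fin N → TwoSphere) → Fin m → EuclideanSpace ℂ ((Fin N → Fin 2) × Fin n) :=
    fun x q => WithLp.toLp 2 (s x q)
  have hfc : ∀ q, Continuous fun x => f x q := fun q =>
    (PiLp.continuous_toLp 2 _).comp (continuous_pi fun p => hsc q p)
  have hfl : ∀ x, LinearIndependent ℂ (f x) := by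
    intro x
    rw [Fintype.linearIndependent_iff]
    intro w hw
    have hw' : ∀ p, ∑ q, w q * s x q p = 0 := by
      intro p
      have := congrArg (fun u : EuclideanSpace ℂ ((Fin N → Fin 2) × Fin n) => u p) hw
      simpa [f] using this
    let B := F.filter fun j => ∃ i ∈ I j, bott (x i) *ᵥ wv (α j) = 0
    have hB : B.card ≤ (F.biUnion I).card := by
      have hex : ∀ j : Fin n, j ∈ B → ∃ i ∈ I j, bott (x i) *ᵥ wv (α j) = 0 := fun j hj =>
        (Finset.mem_filter.mp hj).2
      rcases B.eq_empty_or_nonempty with hB0 | ⟨j0, hj0⟩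
      · rw [hB0]; simp
      obtain ⟨i0, _⟩ := hex j0 hj0
      have : Nonempty (Fin N) := ⟨i0⟩
      choose! c hc hc' using hex
      refine Finset.card_le_card_of_injOn c (fun j hj => ?_) ?_
      · exact Finset.mem_biUnion.mpr ⟨j, (Finset.mem_filter.mp hj).1, hc j hj⟩
      · intro j hj j' hj' h
        have h1 := hc' j hj
        have h2 := hc' j' hj'
        rw [← h] at h2
        exact hα (bott_wv _ h1 h2)
    have hG : m ≤ (F \ B).card := by
      have := Finset.le_card_sdiff B F
      omega
    let e := (F \ B).orderEmbOfCardLe hG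
    have he : ∀ t, e t ∈ F \ B := fun t => Finset.orderEmbOfCardLe_mem _ hG t
    have := Matrix.eq_zero_of_forall_index_sum_pow_mul_eq_zero (f := fun t => α (e t)) (v := w)
      (hα.comp e.injective) (by
        intro t
        obtain ⟨h1, h2⟩ := Finset.mem_sdiff.mp (he t)
        obtain ⟨a, ha⟩ := sec_ne (I (e t)) (α (e t)) x (by
          intro i hi h0
          exact h2 (Finset.mem_filter.mpr ⟨h1, i, hi, h0⟩))
        have h3 := hw' (a, e t)
        simp only [s, h1, if_true] at h3
        apply mul_right_cancel₀ ha
        rw [zero_mul, ← h3, Finset.sum_mul]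
        refine Finset.sum_congr rfl fun q _ => ?_
        ring)
    exact fun i => congrFun this i
  obtain ⟨g, hgc, hgo, hgs⟩ := exists_orthonormal f hfc hfl
  have hQg : ∀ x q, Q x *ᵥ (g x q).ofLp = (g x q).ofLp := by
    intro x q
    refine Submodule.span_induction (p := fun u _ => Q x *ᵥ u.ofLp = u.ofLp) ?_ ?_ ?_ ?_ (hgs x q)
    · rintro _ ⟨q', rfl⟩
      exact hQs x q'
    · simp
    · intro u u' _ _ h h'
      simp [mulVec_add, h, h']
    · intro c u _ h
      simp [mulVec_smul, h]
  let v : (Fin N → TwoSphere) → Matrix ((Fin N → Fin 2) × Fin n) (Fin m) ℂ :=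
    fun x => Matrix.of fun p q => g x q p
  have hQv : ∀ x, Q x * v x = v x := by
    intro x
    ext p q
    exact congrFun (hQg x q) p
  refine ⟨v, ?_, fun x => ⟨?_, ?_⟩⟩
  · refine continuous_pi fun p => continuous_pi fun q => ?_
    exact (EuclideanSpace.proj (𝕜 := ℂ) p).continuous.comp (hgc q)
  · show (v x)ᴴ * v x = 1
    ext q q'
    have h := orthonormal_iff_ite.mp (hgo x) q q'
    rw [Matrix.one_apply, ← h, PiLp.inner_apply, Matrix.mul_apply]
    refine Finset.sum_congr rfl fun p _ => ?_
    simp [v, mul_comm]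
  · have h := congrArg conjTranspose (hQv x)
    rw [conjTranspose_mul] at h
    have h' : (Q x)ᴴ = Q x := Q_herm N n I x
    rw [h'] at h
    rw [Matrix.mul_assoc]
    exact congrArg (v x * ·) h

end Pos
end BottAux

/-- with `Q = ⊕_{j=1}^n p_{I_j}` over `X = ∏_{i=1}^N S²` and `m·e` a
trivial projection of rank `m`, one has: `m·e` is NOT subequivalent to `Q` if and
only if `|F| < |⋃_{j∈F} I_j| + m` for every finite subset `F ⊆ {1,...,n}`. -/
theorem trivial_subequiv_bott_sum_iff (N n m : ℕ) (I : Fin n → Finset (Fin N)) :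
    ¬ CSubequiv (fun _ : Fin N → TwoSphere => (1 : Matrix (Fin m) (Fin m) ℂ))
        (fun x => Matrix.blockDiagonal fun j : Fin n => bottProj N (I j) x)
      ↔ ∀ F : Finset (Fin n), F.card < (F.biUnion I).card + m := by
  constructor
  · intro h F
    by_contra hF
    exact h (BottAux.pos_direction N n m I F (not_lt.mp hF))
  · exact BottAux.neg_direction N n m I
end

section
/- Monotonicity of stability of matrix algebras: if M_n(A) is stable for a C*-algebra A and some n ≥ 1, then M_m(A) is stable for all m ≥ n. -/
attribute [local instance] Matrix.linftyOpNonUnitalNormedRing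

/-- Stability of a C*-algebra (`B ⊗ K ≅ B`), via the Hjelmborg–Rørdam
characterization: for every positive `a` and `ε > 0` there is `v` with
`‖v*v − a‖ < ε` and `‖(vv*)a‖ < ε` (that is, `a` is approximately of the form `v*v`
with `vv*` approximately orthogonal to `a`). -/
def IsStable (B : Type*) [NonUnitalNormedRing B] [StarRing B] : Prop :=
  ∀ a : B, (∃ b : B, a = star b * b) → ∀ ε > (0 : ℝ),
    ∃ v : B, ‖star v * v - a‖ < ε ∧ ‖(v * star v) * a‖ < ε

section Helpers

attribute [local instance] Matrix.linftyOpNormedAddCommGroup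

open Matrix Filter Topology

lemma stab_entry_le {A ι κ : Type*} [NonUnitalCStarAlgebra A] [Fintype ι] [Fintype κ]
    (M : Matrix ι κ A) (i : ι) (j : κ) : ‖M i j‖ ≤ ‖M‖ := by
  have h1 : ‖M i j‖₊ ≤ ∑ j, ‖M i j‖₊ :=
    Finset.single_le_sum (f := fun j => ‖M i j‖₊) (fun _ _ => zero_le) (Finset.mem_univ j)
  have h2 : ∑ j, ‖M i j‖₊ ≤ Finset.univ.sup fun i => ∑ j, ‖M i j‖₊ :=
    Finset.le_sup (f := fun i => ∑ j, ‖M i j‖₊) (Finset.mem_univ i)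
  rw [Matrix.linfty_opNorm_def]
  exact_mod_cast h1.trans h2

lemma stab_norm_le {A ι κ : Type*} [NonUnitalCStarAlgebra A] [Fintype ι] [Fintype κ]
    (M : Matrix ι κ A) (c : ℝ) (hc : 0 ≤ c) (h : ∀ i j, ‖M i j‖ ≤ c) :
    ‖M‖ ≤ Fintype.card κ * c := by
  lift c to NNReal using hc
  rw [Matrix.linfty_opNorm_def]
  have : (Finset.univ.sup fun i => ∑ j, ‖M i j‖₊) ≤ Fintype.card κ * c := by
    refine Finset.sup_le fun i _ => ?_
    calc ∑ j, ‖M i j‖₊ ≤ ∑ _j : κ, c := Finset.sum_le_sum fun j _ => h i j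
      _ = _ := by simp
  exact_mod_cast this

lemma stab_norm_conjTranspose_le {A ι κ : Type*} [NonUnitalCStarAlgebra A] [Fintype ι] [Fintype κ]
    (M : Matrix ι κ A) : ‖Mᴴ‖ ≤ Fintype.card ι * ‖M‖ := by
  refine stab_norm_le _ _ (norm_nonneg _) fun i j => ?_
  rw [conjTranspose_apply, norm_star]
  exact stab_entry_le M j i

lemma stab_sq_le {A ι κ : Type*} [NonUnitalCStarAlgebra A] [Fintype ι] [Fintype κ]
    (M : Matrix ι κ A) (i : ι) (j : κ) : ‖M i j‖ ^ 2 ≤ ‖Mᴴ * M‖ := by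
  let _ := CStarAlgebra.spectralOrder A
  have := CStarAlgebra.spectralOrderedRing A
  refine le_trans ?_ (stab_entry_le _ j j)
  rw [sq, ← CStarRing.norm_star_mul_self, mul_apply]
  refine CStarAlgebra.norm_le_norm_of_nonneg_of_le (star_mul_self_nonneg _) ?_
  exact Finset.single_le_sum (f := fun k => Mᴴ j k * M k j)
    (fun k _ => star_mul_self_nonneg (M k j)) (Finset.mem_univ i)

lemma stab_norm_le_of_sq {A ι κ : Type*} [NonUnitalCStarAlgebra A] [Fintype ι] [Fintype κ]
    (M : Matrix ι κ A) (c : ℝ) (hc : 0 ≤ c) (h : ‖Mᴴ * M‖ ≤ c ^ 2) :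
    ‖M‖ ≤ Fintype.card κ * c :=
  stab_norm_le M c hc fun i j => abs_le_of_sq_le_sq' ((stab_sq_le M i j).trans h) hc |>.2

lemma stab_small (C ε : ℝ) (hC : 0 ≤ C) (hε : 0 < ε) : ∃ δ > 0, δ ≤ 1 ∧ C * δ < ε := by
  refine ⟨min 1 (ε / (C + 1)), by positivity, min_le_left _ _, ?_⟩
  calc C * min 1 (ε / (C + 1)) ≤ C * (ε / (C + 1)) := by gcongr; exact min_le_right _ _
    _ < (C + 1) * (ε / (C + 1)) := by gcongr; linarith
    _ = ε := by field_simp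

/-- Approximate units acting diagonally on a matrix. -/
lemma stab_ev {A : Type*} [NonUnitalCStarAlgebra A] [PartialOrder A] [StarOrderedRing A]
    {ι κ : Type*} [Fintype ι] [DecidableEq ι] [Fintype κ]
    (M : Matrix ι κ A) (δ : ℝ) (hδ : 0 < δ) :
    ∀ᶠ f in CStarAlgebra.approximateUnit A,
      ‖(diagonal fun _ : ι => f) * (diagonal fun _ : ι => f) * M - M‖ < δ := by
  have hl := CStarAlgebra.increasingApproximateUnit A
  have key : ∀ t : A, ∀ η > 0, ∀ᶠ f in CStarAlgebra.approximateUnit A, ‖f * f * t - t‖ < η := by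
    intro t η hη
    have := (hl.tendsto_mul_right t).eventually (Metric.ball_mem_nhds t (half_pos hη))
    filter_upwards [this, hl.eventually_norm] with f h1 h2
    rw [dist_eq_norm] at h1
    have e : f * f * t - t = f * (f * t - t) + (f * t - t) := by noncomm_ring
    have h3 : ‖f * (f * t - t)‖ ≤ ‖f * t - t‖ :=
      (norm_mul_le _ _).trans (mul_le_of_le_one_left (norm_nonneg _) h2)
    rw [e]
    linarith [norm_add_le (f * (f * t - t)) (f * t - t)]
  obtain ⟨c, hc, -, hc'⟩ := stab_small (Fintype.card κ) δ (by positivity) hδ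
  have : ∀ᶠ f in CStarAlgebra.approximateUnit A, ∀ i j, ‖f * f * M i j - M i j‖ < c := by
    rw [eventually_all]
    intro i
    rw [eventually_all]
    intro j
    exact key _ _ hc
  filter_upwards [this] with f hf
  refine lt_of_le_of_lt (stab_norm_le _ c hc.le fun i j => ?_) hc'
  rw [diagonal_mul_diagonal, Matrix.sub_apply, diagonal_mul]
  exact (hf i j).le

lemma stab_approx {A : Type*} [NonUnitalCStarAlgebra A] {ι κ₁ κ₂ κ₃ : Type*}
    [Fintype ι] [DecidableEq ι] [Fintype κ₁] [Fintype κ₂] [Fintype κ₃]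
    (x : Matrix ι κ₁ A) (y : Matrix ι κ₂ A) (z : Matrix ι κ₃ A) (δ : ℝ) (hδ : 0 < δ) :
    ∃ F : Matrix ι ι A, ‖star F * F‖ ≤ 1 ∧ ‖star F * F * x - x‖ < δ ∧ ‖star F * F * y - y‖ < δ ∧
      ‖star F * F * z - z‖ < δ := by
  let _ := CStarAlgebra.spectralOrder A
  have := CStarAlgebra.spectralOrderedRing A
  have hl := CStarAlgebra.increasingApproximateUnit A
  obtain ⟨f, h1, h2, h3, h4, h5⟩ := ((stab_ev x δ hδ).and ((stab_ev y δ hδ).and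
    ((stab_ev z δ hδ).and (hl.eventually_norm.and hl.eventually_star_eq)))).exists
  have hF : star (diagonal fun _ : ι => f) = diagonal fun _ : ι => f := by
    rw [star_eq_conjTranspose, diagonal_conjTranspose]
    congr 1
    ext i
    exact h5
  refine ⟨diagonal fun _ => f, ?_, ?_, ?_, ?_⟩ <;> rw [hF]
  · have : ‖diagonal fun _ : ι => f‖ ≤ 1 := by
      rw [linfty_opNorm_diagonal]
      exact (pi_norm_le_iff_of_nonneg zero_le_one).2 fun _ => h4
    exact (linfty_opNorm_mul _ _).trans (mul_le_one₀ this (norm_nonneg _) this)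
  · exact h1
  · exact h2
  · exact h3

lemma stab_y {A : Type*} [NonUnitalCStarAlgebra A] {n : ℕ} {ι κ : Type*}
    [Fintype ι] [Fintype κ]
    (z : Matrix (Fin n) ι A) (y : Matrix (Fin n) κ A) (ε : ℝ) (hε : 0 < ε) :
    ∃ δ₀ > 0, ∀ v G : Matrix (Fin n) (Fin n) A, ‖v‖ ≤ n * 2 → ‖v * vᴴ * G‖ ≤ δ₀ →
      ‖G * y - y‖ ≤ δ₀ → ‖(v * z)ᴴ * y‖ < ε := by
  obtain ⟨c, hc, -, hc'⟩ := stab_small (‖zᴴ‖ * Fintype.card κ) ε (by positivity) hε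
  obtain ⟨δ, hδ, -, hδ'⟩ := stab_small (‖yᴴ‖ * (‖y‖ + (n * 2) * (n * (n * 2)))) (c ^ 2)
    (by positivity) (by positivity)
  refine ⟨δ, hδ, fun v G hv hG hy => ?_⟩
  have hvs : ‖vᴴ‖ ≤ n * (n * 2) := by
    refine (stab_norm_conjTranspose_le v).trans ?_
    rw [Fintype.card_fin]
    gcongr
  have hvv : ‖v * vᴴ‖ ≤ (n * 2) * (n * (n * 2)) := by
    refine (linfty_opNorm_mul _ _).trans ?_
    gcongr
  have e : (vᴴ * y)ᴴ * (vᴴ * y) = yᴴ * (v * vᴴ * G * y - v * vᴴ * (G * y - y)) := by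
    simp only [conjTranspose_mul, conjTranspose_conjTranspose, Matrix.mul_sub, Matrix.mul_assoc]
    abel
  have h1 : ‖(vᴴ * y)ᴴ * (vᴴ * y)‖ ≤ c ^ 2 := by
    rw [e]
    refine le_trans ?_ hδ'.le
    calc _ ≤ ‖yᴴ‖ * ‖v * vᴴ * G * y - v * vᴴ * (G * y - y)‖ := linfty_opNorm_mul _ _
      _ ≤ ‖yᴴ‖ * (‖v * vᴴ * G * y‖ + ‖v * vᴴ * (G * y - y)‖) := by gcongr; exact norm_sub_le _ _
      _ ≤ ‖yᴴ‖ * (‖v * vᴴ * G‖ * ‖y‖ + ‖v * vᴴ‖ * ‖G * y - y‖) := by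
        gcongr <;> exact linfty_opNorm_mul _ _
      _ ≤ ‖yᴴ‖ * (δ * ‖y‖ + ((n * 2) * (n * (n * 2))) * δ) := by gcongr
      _ = _ := by ring
  have h2 := stab_norm_le_of_sq _ c hc.le h1
  rw [conjTranspose_mul, Matrix.mul_assoc]
  calc _ ≤ ‖zᴴ‖ * ‖vᴴ * y‖ := linfty_opNorm_mul _ _
    _ ≤ ‖zᴴ‖ * (Fintype.card κ * c) := by gcongr
    _ = ‖zᴴ‖ * Fintype.card κ * c := by ring
    _ < ε := hc'

/-- Main consequence of stability. -/
lemma stab_main {A : Type*} [NonUnitalCStarAlgebra A] {n : ℕ} {ι κ₁ κ₂ : Type*}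
    [Fintype ι] [Fintype κ₁] [Fintype κ₂]
    (hs : IsStable (Matrix (Fin n) (Fin n) A))
    (z : Matrix (Fin n) ι A) (y₁ : Matrix (Fin n) κ₁ A) (y₂ : Matrix (Fin n) κ₂ A)
    (ε : ℝ) (hε : 0 < ε) :
    ∃ x : Matrix (Fin n) ι A, ‖xᴴ * x - zᴴ * z‖ < ε ∧ ‖xᴴ * y₁‖ < ε ∧ ‖xᴴ * y₂‖ < ε := by
  obtain ⟨δ₁, hδ₁, H₁⟩ := stab_y z y₁ ε hε
  obtain ⟨δ₂, hδ₂, H₂⟩ := stab_y z y₂ ε hε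
  obtain ⟨δ₃, hδ₃, hδ₃1, H₃⟩ := stab_small (‖zᴴ‖ * (‖z‖ + 1)) ε (by positivity) hε
  have hδ : 0 < min δ₁ (min δ₂ δ₃) := by positivity
  have l1 : min δ₁ (min δ₂ δ₃) ≤ δ₁ := min_le_left _ _
  have l2 : min δ₁ (min δ₂ δ₃) ≤ δ₂ := (min_le_right _ _).trans (min_le_left _ _)
  have l3 : min δ₁ (min δ₂ δ₃) ≤ δ₃ := (min_le_right _ _).trans (min_le_right _ _)
  generalize min δ₁ (min δ₂ δ₃) = δ at hδ l1 l2 l3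
  obtain ⟨F, hF, hz, hy₁, hy₂⟩ := stab_approx z y₁ y₂ δ hδ
  obtain ⟨v, hv, hv'⟩ := hs (star F * F) ⟨F, rfl⟩ δ hδ
  generalize star F * F = G at *
  rw [star_eq_conjTranspose] at hv hv'
  have hvn : ‖v‖ ≤ n * 2 := by
    have := stab_norm_le_of_sq v 2 (by norm_num) ?_
    · simpa using this
    · have : ‖vᴴ * v‖ ≤ ‖vᴴ * v - G‖ + ‖G‖ := by
        simpa using norm_add_le (vᴴ * v - G) G
      have h4 : ‖vᴴ * v - G‖ < δ := hv
      linarith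
  refine ⟨v * z, ?_, H₁ v G hvn (hv'.le.trans l1) (hy₁.le.trans l1),
    H₂ v G hvn (hv'.le.trans l2) (hy₂.le.trans l2)⟩
  have e : (v * z)ᴴ * (v * z) - zᴴ * z = zᴴ * ((vᴴ * v - G) * z + (G * z - z)) := by
    simp only [conjTranspose_mul, Matrix.mul_add, Matrix.mul_sub, Matrix.sub_mul, Matrix.mul_assoc]
    abel
  rw [e]
  calc _ ≤ ‖zᴴ‖ * ‖(vᴴ * v - G) * z + (G * z - z)‖ := linfty_opNorm_mul _ _
    _ ≤ ‖zᴴ‖ * (‖(vᴴ * v - G) * z‖ + ‖G * z - z‖) := by gcongr; exact norm_add_le _ _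
    _ ≤ ‖zᴴ‖ * (‖vᴴ * v - G‖ * ‖z‖ + ‖G * z - z‖) := by gcongr; exact linfty_opNorm_mul _ _
    _ ≤ ‖zᴴ‖ * (δ₃ * ‖z‖ + δ₃) := by
      gcongr
      · exact hv.le.trans l3
      · exact hz.le.trans l3
    _ = ‖zᴴ‖ * (‖z‖ + 1) * δ₃ := by ring
    _ < ε := H₃

/-- Append a zero row. -/
def stabPad {A : Type*} [Zero A] {n : ℕ} {κ : Type*} (x : Matrix (Fin n) κ A) :
    Matrix (Fin (n + 1)) κ A :=
  Matrix.of fun i j => Fin.lastCases (motive := fun _ => A) 0 (fun k => x k j) i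

lemma stabPad_mul {A : Type*} [NonUnitalCStarAlgebra A] {n : ℕ} {ι κ : Type*}
    (x : Matrix (Fin n) ι A) (M : Matrix (Fin (n + 1)) κ A) :
    (stabPad x)ᴴ * M = xᴴ * M.submatrix Fin.castSucc id := by
  ext i j
  simp [mul_apply, Fin.sum_univ_castSucc, stabPad]

lemma stabPad_submatrix {A : Type*} [NonUnitalCStarAlgebra A] {n : ℕ} {ι : Type*}
    (x : Matrix (Fin n) ι A) : (stabPad x).submatrix Fin.castSucc id = x := by
  ext i j
  simp [stabPad]

lemma stab_succ {A : Type*} [NonUnitalCStarAlgebra A] (n : ℕ) (hn : 1 ≤ n)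
    (hs : IsStable (Matrix (Fin n) (Fin n) A)) :
    IsStable (Matrix (Fin (n + 1)) (Fin (n + 1)) A) := by
  rintro a ⟨b, hb⟩ ε hε
  rw [star_eq_conjTranspose] at hb
  obtain ⟨k, rfl⟩ : ∃ k, n = k + 1 := ⟨n - 1, by omega⟩
  set z₁ : Matrix (Fin (k + 1)) (Fin (k + 1 + 1)) A := b.submatrix Fin.castSucc id with hz₁
  set z₂ : Matrix (Fin (k + 1)) (Fin (k + 1 + 1)) A :=
    Matrix.of fun i j => if i = 0 then b (Fin.last _) j else 0 with hz₂
  have hsum : a = z₁ᴴ * z₁ + z₂ᴴ * z₂ := by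
    rw [hb]
    ext i j
    rw [mul_apply, Fin.sum_univ_castSucc, Matrix.add_apply, mul_apply, mul_apply]
    congr 1
    rw [Finset.sum_eq_single 0]
    · simp [hz₂]
    · intro i _ hi
      simp [hz₂, hi]
    · simp
  set y := a.submatrix (Fin.castSucc (n := k + 1)) id with hy
  set N : ℝ := ((k + 1 + 1 : ℕ) : ℝ) with hN
  obtain ⟨δ, hδ, hδ1, hδ'⟩ := stab_small (3 + N + 2 * (N * (‖a‖ + 1 + ε))) ε
    (by positivity) hε
  obtain ⟨x₁, h11, h12, -⟩ := stab_main hs z₁ y y δ hδ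
  obtain ⟨x₂, h21, h22, h23⟩ := stab_main hs z₂ y x₁ δ hδ
  have h24 : ‖x₁ᴴ * x₂‖ ≤ N * δ := by
    have := stab_norm_conjTranspose_le (x₂ᴴ * x₁)
    rw [conjTranspose_mul, conjTranspose_conjTranspose, Fintype.card_fin] at this
    exact this.trans (by gcongr)
  set v := stabPad (x₁ + x₂) with hv
  have e1 : vᴴ * v - a = (x₁ᴴ * x₁ - z₁ᴴ * z₁) + (x₂ᴴ * x₂ - z₂ᴴ * z₂) + x₂ᴴ * x₁ + x₁ᴴ * x₂ := by
    rw [hv, stabPad_mul, stabPad_submatrix, hsum]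
    simp only [conjTranspose_add, Matrix.mul_add, Matrix.add_mul]
    abel
  have n1 : ‖vᴴ * v - a‖ ≤ (3 + N) * δ := by
    rw [e1]
    have t1 := norm_add_le ((x₁ᴴ * x₁ - z₁ᴴ * z₁) + (x₂ᴴ * x₂ - z₂ᴴ * z₂) + x₂ᴴ * x₁) (x₁ᴴ * x₂)
    have t2 := norm_add_le ((x₁ᴴ * x₁ - z₁ᴴ * z₁) + (x₂ᴴ * x₂ - z₂ᴴ * z₂)) (x₂ᴴ * x₁)
    have t3 := norm_add_le (x₁ᴴ * x₁ - z₁ᴴ * z₁) (x₂ᴴ * x₂ - z₂ᴴ * z₂)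
    linarith
  have hN0 : 0 ≤ N := by positivity
  have hpos : 0 ≤ 2 * (N * (‖a‖ + 1 + ε)) * δ := by positivity
  have n2 : ‖vᴴ * v - a‖ < ε := by
    refine lt_of_le_of_lt n1 ?_
    linarith
  refine ⟨v, n2, ?_⟩
  have hvn : ‖v‖ ≤ N * (‖a‖ + 1 + ε) := by
    have := stab_norm_le_of_sq v (‖a‖ + 1 + ε) (by positivity) ?_
    · simpa [hN] using this
    · have h3 : ‖vᴴ * v‖ ≤ ‖vᴴ * v - a‖ + ‖a‖ := by
        simpa using norm_add_le (vᴴ * v - a) a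
      nlinarith [norm_nonneg a]
  have e2 : v * star v * a = v * (x₁ᴴ * y + x₂ᴴ * y) := by
    rw [star_eq_conjTranspose, Matrix.mul_assoc]
    congr 1
    rw [hv, stabPad_mul, conjTranspose_add, Matrix.add_mul]
  rw [e2]
  calc _ ≤ ‖v‖ * ‖x₁ᴴ * y + x₂ᴴ * y‖ := linfty_opNorm_mul _ _
    _ ≤ ‖v‖ * (‖x₁ᴴ * y‖ + ‖x₂ᴴ * y‖) := by gcongr; exact norm_add_le _ _
    _ ≤ (N * (‖a‖ + 1 + ε)) * (δ + δ) := by gcongr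
    _ = 2 * (N * (‖a‖ + 1 + ε)) * δ := by ring
    _ ≤ (3 + N + 2 * (N * (‖a‖ + 1 + ε))) * δ := by gcongr; linarith
    _ < ε := hδ'

end Helpers

/-- if `M_n(A)` is stable for some `n ≥ 1`, then `M_m(A)` is stable
for all `m ≥ n`. -/
theorem matrix_stable_mono {A : Type*} [NonUnitalCStarAlgebra A] (n : ℕ) (hn : 1 ≤ n)
    (hstable : IsStable (Matrix (Fin n) (Fin n) A)) :
    ∀ m : ℕ, n ≤ m → IsStable (Matrix (Fin m) (Fin m) A) := by
  intro m hm
  induction m, hm using Nat.le_induction with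
  | base => exact hstable
  | succ m hm ih => exact stab_succ m (hn.trans hm) ih
end
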